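/- arXiv:2003.11508 — 2 statements merged into one kernel-verified Lean document; each statement's English description precedes it below -/
import Mathlib

section
/- Let P ∈ ℂ[x] be a polynomial of degree n ≥ 1 that is real on the imaginary axis, and suppose that P has at least three roots α, counted with multiplicity, satisfying |Re α| < 1. Then the regular bimodule 𝒜(P) is unitarizable, i.e. there exists a positive definite invariant Hermitian form on 𝒜(P). -/
open Polynomial
open scoped Classical

noncomputable section

abbrev FA : Type := FreeAlgebra ℂ (Fin 3)

def Egen : FA := FreeAlgebra.ι ℂ 0
def Fgen : FA := FreeAlgebra.ι ℂ 1
def Hgen : FA := FreeAlgebra.ι ℂ 2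

/-- The defining relations of the deformation `𝒜(P)` of the type A Kleinian singularity:
`he − eh = 2e`, `hf − fh = −2f`, `ef = P(h−1)`, `fe = P(h+1)`. -/
inductive ARel (P : ℂ[X]) : FA → FA → Prop
  | he : ARel P (Hgen * Egen - Egen * Hgen) (2 * Egen)
  | hf : ARel P (Hgen * Fgen - Fgen * Hgen) (-(2 * Fgen))
  | ef : ARel P (Egen * Fgen) (Polynomial.aeval (Hgen - 1) P)
  | fe : ARel P (Fgen * Egen) (Polynomial.aeval (Hgen + 1) P)

/-- The algebra `𝒜(P)`. -/
abbrev AP (P : ℂ[X]) : Type := RingQuot (ARel P)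

def eA (P : ℂ[X]) : AP P := RingQuot.mkAlgHom ℂ (ARel P) Egen
def fA (P : ℂ[X]) : AP P := RingQuot.mkAlgHom ℂ (ARel P) Fgen
def hA (P : ℂ[X]) : AP P := RingQuot.mkAlgHom ℂ (ARel P) Hgen

/-- `P` is real on the imaginary axis: `P(it) ∈ ℝ` for all real `t`. -/
def RealOnIm (P : ℂ[X]) : Prop := ∀ t : ℝ, ∃ r : ℝ, P.eval (Complex.I * t) = r

/-- An invariant Hermitian (sesquilinear) form on the regular bimodule `𝒜(P)`. -/
structure InvForm (P : ℂ[X]) where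
  B : AP P → AP P → ℂ
  add_left : ∀ u v w, B (u + v) w = B u w + B v w
  smul_left : ∀ (c : ℂ) (u v), B (c • u) v = c * B u v
  conj_symm : ∀ u v, B u v = starRingEnd ℂ (B v u)
  e_left : ∀ u v, B (eA P * u) v = - B u (v * fA P)
  h_left : ∀ u v, B (hA P * u) v = - B u (v * hA P)
  f_left : ∀ u v, B (fA P * u) v = - B u (v * eA P)
  e_right : ∀ u v, B (u * eA P) v = - B u (fA P * v)
  h_right : ∀ u v, B (u * hA P) v = - B u (hA P * v)
  f_right : ∀ u v, B (u * fA P) v = - B u (eA P * v)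

/-- The regular bimodule `𝒜(P)` is unitarizable: there is a positive definite
invariant Hermitian form on it. -/
def Unitarizable (P : ℂ[X]) : Prop :=
  ∃ Φ : InvForm P, ∀ u : AP P, u ≠ 0 → ∃ r : ℝ, 0 < r ∧ Φ.B u u = r

/-- Mathlib's subtraction on `RingQuot` is not the reducible one, which blocks rewriting. -/
instance apRing (P : ℂ[X]) : Ring (AP P) := Algebra.semiringToRing ℂ

instance apNeg (P : ℂ[X]) : Neg (AP P) := (apRing P).toNeg

instance apSub (P : ℂ[X]) : Sub (AP P) := (apRing P).toSub

/-- The image of a polynomial under evaluation at `h`. -/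
def hEval (P : ℂ[X]) : ℂ[X] →ₐ[ℂ] AP P := aeval (hA P)

theorem AP.induction {P : ℂ[X]} {C : AP P → Prop} (scalar : ∀ r, C (algebraMap ℂ (AP P) r))
    (e : C (eA P)) (f : C (fA P)) (h : C (hA P)) (mul : ∀ a b, C a → C b → C (a * b))
    (add : ∀ a b, C a → C b → C (a + b)) (a : AP P) : C a := by
  obtain ⟨x, rfl⟩ := RingQuot.mkAlgHom_surjective ℂ (ARel P) a
  induction x using FreeAlgebra.induction with
  | grade0 r => simpa using scalar r
  | grade1 i => fin_cases i
                · exact e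
                · exact f
                · exact h
  | mul a b ha hb => simpa using mul _ _ ha hb
  | add a b ha hb => simpa using add _ _ ha hb

theorem hA_mul_eA (P : ℂ[X]) : hA P * eA P = eA P * (hA P + 2) := by
  have := RingQuot.mkAlgHom_rel ℂ (ARel.he (P := P))
  simp only [map_sub, map_mul, map_ofNat] at this
  change hA P * eA P - eA P * hA P = 2 * eA P at this
  rw [mul_add, mul_two, ← two_mul, ← this]
  abel

theorem hA_mul_fA (P : ℂ[X]) : hA P * fA P = fA P * (hA P - 2) := by
  have := RingQuot.mkAlgHom_rel ℂ (ARel.hf (P := P))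
  simp only [map_sub, map_mul, map_ofNat, map_neg] at this
  change hA P * fA P - fA P * hA P = -(2 * fA P) at this
  rw [mul_sub, mul_two, ← two_mul, sub_eq_add_neg (fA P * hA P), ← this]
  abel

theorem aeval_hA_add (P R : ℂ[X]) (c : ℂ) :
    aeval (hA P + algebraMap ℂ _ c) R = hEval P (taylor c R) := by
  rw [taylor_apply, hEval, aeval_comp]
  simp

theorem eA_mul_fA (P : ℂ[X]) : eA P * fA P = hEval P (taylor (-1) P) := by
  have := RingQuot.mkAlgHom_rel ℂ (ARel.ef (P := P))
  rw [map_mul, ← aeval_algHom_apply] at this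
  change eA P * fA P = _ at this
  rw [this, ← aeval_hA_add]
  simp [hA, sub_eq_add_neg]

theorem fA_mul_eA (P : ℂ[X]) : fA P * eA P = hEval P (taylor 1 P) := by
  have := RingQuot.mkAlgHom_rel ℂ (ARel.fe (P := P))
  rw [map_mul, ← aeval_algHom_apply] at this
  change fA P * eA P = _ at this
  rw [this, ← aeval_hA_add]
  simp [hA]

theorem mul_aeval_of_mul_eq {A : Type*} [Ring A] [Algebra ℂ A] {x y a : A} (h : x * a = a * y)
    (R : ℂ[X]) : aeval x R * a = a * aeval y R := by
  induction R using Polynomial.induction_on with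
  | C c => simp [Algebra.commutes]
  | add p q hp hq => simp [add_mul, mul_add, hp, hq]
  | monomial n c ih =>
    simp only [pow_succ, map_mul, map_pow, aeval_X, aeval_C] at ih ⊢
    rw [← mul_assoc, mul_assoc, h, ← mul_assoc, ih]
    simp only [mul_assoc]

theorem eA_mul_hEval (P R : ℂ[X]) : eA P * hEval P R = hEval P (taylor (-2) R) * eA P := by
  have := mul_aeval_of_mul_eq (hA_mul_eA P) (taylor (-2) R)
  have h2 := aeval_hA_add P (taylor (-2) R) 2
  rw [taylor_taylor] at h2
  simp only [map_ofNat, add_neg_cancel, taylor_zero] at h2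
  rw [h2] at this
  exact this.symm

theorem fA_mul_hEval (P R : ℂ[X]) : fA P * hEval P R = hEval P (taylor 2 R) * fA P := by
  have := mul_aeval_of_mul_eq (hA_mul_fA P) (taylor 2 R)
  have h2 := aeval_hA_add P (taylor 2 R) (-2)
  rw [taylor_taylor] at h2
  simp only [map_ofNat, map_neg, neg_add_cancel, taylor_zero, ← sub_eq_add_neg] at h2
  rw [h2] at this
  exact this.symm

/-- `e ^ k` for `k ≥ 0` and `f ^ (-k)` for `k ≤ 0`. -/
def wtGen (P : ℂ[X]) (k : ℤ) : AP P := eA P ^ k.toNat * fA P ^ (-k).toNat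

/-- The span of the `R(h) e ^ k`, resp. `R(h) f ^ (-k)`. -/
def wtSpace (P : ℂ[X]) (k : ℤ) : Submodule ℂ (AP P) :=
  LinearMap.range ((LinearMap.mulRight ℂ (wtGen P k)).comp (hEval P).toLinearMap)

theorem mem_wtSpace {P : ℂ[X]} {k : ℤ} {a : AP P} :
    a ∈ wtSpace P k ↔ ∃ R, hEval P R * wtGen P k = a := Iff.rfl

theorem hA_mul_mem {P : ℂ[X]} {k : ℤ} {a : AP P} (ha : a ∈ wtSpace P k) :
    hA P * a ∈ wtSpace P k := by
  obtain ⟨R, rfl⟩ := mem_wtSpace.1 ha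
  exact mem_wtSpace.2 ⟨X * R, by rw [map_mul, hEval, aeval_X, mul_assoc]⟩

theorem eA_mul_mem {P : ℂ[X]} {k : ℤ} {a : AP P} (ha : a ∈ wtSpace P k) :
    eA P * a ∈ wtSpace P (k + 1) := by
  obtain ⟨R, rfl⟩ := mem_wtSpace.1 ha
  rw [← mul_assoc, eA_mul_hEval, mul_assoc]
  rcases le_or_gt 0 k with hk | hk
  · refine mem_wtSpace.2 ⟨_, congrArg _ ?_⟩
    lift k to ℕ using hk
    have h1 : ((k : ℤ) + 1).toNat = k + 1 := by omega
    have h2 : (-((k : ℤ) + 1)).toNat = 0 := by omega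
    simp only [wtGen, h1, h2, pow_succ', mul_assoc, Int.toNat_natCast, Int.toNat_neg_natCast]
  · obtain ⟨j, rfl⟩ : ∃ j : ℕ, k = -((j : ℤ) + 1) := ⟨(-k - 1).toNat, by omega⟩
    refine mem_wtSpace.2 ⟨taylor (-2) R * taylor (-1) P, ?_⟩
    have h1 : ((j : ℤ) + 1).toNat = j + 1 := by omega
    have h2 : (-((j : ℤ) + 1)).toNat = 0 := by omega
    have h3 : (-((j : ℤ) + 1) + 1).toNat = 0 := by omega
    have h4 : (-(-((j : ℤ) + 1) + 1)).toNat = j := by omega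
    simp only [wtGen, h1, h2, h3, h4, neg_neg, pow_zero, one_mul, map_mul, pow_succ',
      ← eA_mul_fA, mul_assoc]

theorem fA_mul_mem {P : ℂ[X]} {k : ℤ} {a : AP P} (ha : a ∈ wtSpace P k) :
    fA P * a ∈ wtSpace P (k - 1) := by
  obtain ⟨R, rfl⟩ := mem_wtSpace.1 ha
  rw [← mul_assoc, fA_mul_hEval, mul_assoc]
  rcases le_or_gt k 0 with hk | hk
  · obtain ⟨j, rfl⟩ : ∃ j : ℕ, k = -(j : ℤ) := ⟨(-k).toNat, by omega⟩
    refine mem_wtSpace.2 ⟨_, congrArg _ ?_⟩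
    have h1 : (-(j : ℤ) - 1).toNat = 0 := by omega
    have h2 : (-(-(j : ℤ) - 1)).toNat = j + 1 := by omega
    simp only [wtGen, h1, h2, pow_succ', neg_neg, Int.toNat_natCast, Int.toNat_neg_natCast,
      pow_zero, one_mul]
  · obtain ⟨j, rfl⟩ : ∃ j : ℕ, k = (j : ℤ) + 1 := ⟨(k - 1).toNat, by omega⟩
    refine mem_wtSpace.2 ⟨taylor 2 R * taylor 1 P, ?_⟩
    have h1 : ((j : ℤ) + 1).toNat = j + 1 := by omega
    have h2 : (-((j : ℤ) + 1)).toNat = 0 := by omega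
    have h3 : ((j : ℤ) + 1 - 1).toNat = j := by omega
    have h4 : (-((j : ℤ) + 1 - 1)).toNat = 0 := by omega
    simp only [wtGen, h1, h2, h3, h4, pow_zero, mul_one, map_mul, pow_succ',
      ← fA_mul_eA, mul_assoc]

theorem mul_mem_iSup_wtSpace {P : ℂ[X]} (a : AP P) :
    ∀ v ∈ ⨆ k, wtSpace P k, a * v ∈ ⨆ k, wtSpace P k := by
  have aux (a : AP P) (h : ∀ k, ∀ v ∈ wtSpace P k, a * v ∈ ⨆ k, wtSpace P k) :
      ∀ v ∈ ⨆ k, wtSpace P k, a * v ∈ ⨆ k, wtSpace P k := by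
    intro v hv
    induction hv using Submodule.iSup_induction' with
    | mem k v hv => exact h k v hv
    | zero => simp
    | add x y _ _ hx hy => rw [mul_add]; exact add_mem hx hy
  induction a using AP.induction with
  | scalar r => exact fun v hv => by rw [← Algebra.smul_def]; exact Submodule.smul_mem _ _ hv
  | e => exact aux _ fun k v hv => Submodule.mem_iSup_of_mem _ (eA_mul_mem hv)
  | f => exact aux _ fun k v hv => Submodule.mem_iSup_of_mem _ (fA_mul_mem hv)
  | h => exact aux _ fun k v hv => Submodule.mem_iSup_of_mem _ (hA_mul_mem hv)
  | mul a b ha hb => exact fun v hv => by rw [mul_assoc]; exact ha _ (hb v hv)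
  | add a b ha hb => exact fun v hv => by rw [add_mul]; exact add_mem (ha v hv) (hb v hv)

theorem iSup_wtSpace (P : ℂ[X]) : ⨆ k, wtSpace P k = ⊤ := by
  refine eq_top_iff.2 fun a _ => ?_
  rw [← mul_one a]
  refine mul_mem_iSup_wtSpace a _ (Submodule.mem_iSup_of_mem 0 (mem_wtSpace.2 ⟨1, ?_⟩))
  simp [wtGen]

theorem exists_sum_wtSpace {P : ℂ[X]} (a : AP P) :
    ∃ (s : Finset ℤ) (c : ℤ → AP P), (∀ k, c k ∈ wtSpace P k) ∧ a = ∑ k ∈ s, c k := by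
  have ha : a ∈ ⨆ k, wtSpace P k := by simp [iSup_wtSpace]
  obtain ⟨g, hg⟩ := (Submodule.mem_iSup_iff_exists_dfinsupp' _ a).1 ha
  exact ⟨g.support, fun k => g k, fun k => (g k).2, hg.symm⟩

theorem hEval_mem (P R : ℂ[X]) : hEval P R ∈ wtSpace P 0 :=
  mem_wtSpace.2 ⟨R, by simp [wtGen]⟩

theorem eA_mem (P : ℂ[X]) : eA P ∈ wtSpace P 1 := by
  simpa using eA_mul_mem (hEval_mem P 1)

theorem fA_mem (P : ℂ[X]) : fA P ∈ wtSpace P (-1) := by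
  simpa using fA_mul_mem (hEval_mem P 1)

theorem hA_mem (P : ℂ[X]) : hA P ∈ wtSpace P 0 := by
  simpa using hA_mul_mem (hEval_mem P 1)

theorem hEval_mul_mem {P : ℂ[X]} (R : ℂ[X]) {k : ℤ} {a : AP P} (ha : a ∈ wtSpace P k) :
    hEval P R * a ∈ wtSpace P k := by
  obtain ⟨S, rfl⟩ := mem_wtSpace.1 ha
  exact mem_wtSpace.2 ⟨R * S, by rw [map_mul, mul_assoc]⟩

theorem mul_mem_wtSpace {P : ℂ[X]} {k l : ℤ} {a b : AP P} (ha : a ∈ wtSpace P k)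
    (hb : b ∈ wtSpace P l) : a * b ∈ wtSpace P (k + l) := by
  have he (n : ℕ) : ∀ {l : ℤ} {b : AP P}, b ∈ wtSpace P l → eA P ^ n * b ∈ wtSpace P (n + l) := by
    induction n with
    | zero => simp
    | succ n ih =>
      intro l b hb
      have := eA_mul_mem (ih hb)
      rwa [← mul_assoc, ← pow_succ', show (n + l + 1 : ℤ) = (n + 1 : ℕ) + l by push_cast; ring]
        at this
  have hf (n : ℕ) : ∀ {l : ℤ} {b : AP P}, b ∈ wtSpace P l → fA P ^ n * b ∈ wtSpace P (-n + l) := by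
    induction n with
    | zero => simp
    | succ n ih =>
      intro l b hb
      have := fA_mul_mem (ih hb)
      rwa [← mul_assoc, ← pow_succ', show (-n + l - 1 : ℤ) = -(n + 1 : ℕ) + l by push_cast; ring]
        at this
  obtain ⟨R, rfl⟩ := mem_wtSpace.1 ha
  have := hEval_mul_mem R (he k.toNat (hf (-k).toNat hb))
  rwa [← mul_assoc, ← mul_assoc, mul_assoc (hEval P R),
    show ((k.toNat : ℤ) + (-((-k).toNat : ℤ) + l)) = k + l by omega] at this

theorem mem_wtSpace_neg_one {P : ℂ[X]} {a : AP P} (ha : a ∈ wtSpace P (-1)) :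
    ∃ R, a = hEval P R * fA P := by
  obtain ⟨R, rfl⟩ := mem_wtSpace.1 ha
  exact ⟨R, by simp [wtGen]⟩

theorem mem_wtSpace_one {P : ℂ[X]} {a : AP P} (ha : a ∈ wtSpace P 1) :
    ∃ R, a = hEval P R * eA P := by
  obtain ⟨R, rfl⟩ := mem_wtSpace.1 ha
  exact ⟨R, by simp [wtGen]⟩

theorem mem_wtSpace_zero {P : ℂ[X]} {a : AP P} (ha : a ∈ wtSpace P 0) :
    ∃ R, a = hEval P R := by
  obtain ⟨R, rfl⟩ := mem_wtSpace.1 ha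
  exact ⟨R, by simp [wtGen]⟩

/-- The action of `h` on `ℂ[x][σ, σ⁻¹]`. -/
def opH : Module.End ℂ (ℤ → ℂ[X]) :=
  LinearMap.pi fun k => (LinearMap.mulLeft ℂ X).comp (LinearMap.proj k)

/-- The action of `e = σ` on `ℂ[x][σ, σ⁻¹]`. -/
def opE : Module.End ℂ (ℤ → ℂ[X]) :=
  LinearMap.pi fun k => (taylor (-2)).comp (LinearMap.proj (k - 1))

/-- The action of `f = σ⁻¹ P(x - 1)` on `ℂ[x][σ, σ⁻¹]`. -/
def opF (P : ℂ[X]) : Module.End ℂ (ℤ → ℂ[X]) :=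
  LinearMap.pi fun k =>
    (LinearMap.mulLeft ℂ (taylor 1 P)).comp ((taylor 2).comp (LinearMap.proj (k + 1)))

@[simp] theorem opH_apply (g : ℤ → ℂ[X]) (k : ℤ) : opH g k = X * g k := rfl

@[simp] theorem opE_apply (g : ℤ → ℂ[X]) (k : ℤ) : opE g k = taylor (-2) (g (k - 1)) := rfl

@[simp] theorem opF_apply (P : ℂ[X]) (g : ℤ → ℂ[X]) (k : ℤ) :
    opF P g k = taylor 1 P * taylor 2 (g (k + 1)) := rfl

theorem aeval_opH_add (R : ℂ[X]) (c : ℂ) (g : ℤ → ℂ[X]) (k : ℤ) :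
    aeval (opH + algebraMap ℂ _ c) R g k = taylor c R * g k := by
  induction R using Polynomial.induction_on generalizing g with
  | C a => simp [Algebra.algebraMap_eq_smul_one, smul_eq_C_mul]
  | add p q hp hq => simp [add_mul, hp, hq]
  | monomial n a ih =>
    rw [pow_succ, ← mul_assoc, map_mul, Module.End.mul_apply, ih, taylor_mul, mul_assoc]
    simp [Algebra.algebraMap_eq_smul_one, smul_eq_C_mul]
    ring

/-- The representation of `𝒜(P)` on `ℂ[x][σ, σ⁻¹]`. -/
def rep (P : ℂ[X]) : AP P →ₐ[ℂ] Module.End ℂ (ℤ → ℂ[X]) :=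
  RingQuot.liftAlgHom ℂ ⟨FreeAlgebra.lift ℂ ![opE, opF P, opH], by
    have hE : FreeAlgebra.lift ℂ ![opE, opF P, opH] Egen = opE := by simp [Egen]
    have hF : FreeAlgebra.lift ℂ ![opE, opF P, opH] Fgen = opF P := by simp [Fgen]
    have hH : FreeAlgebra.lift ℂ ![opE, opF P, opH] Hgen = opH := by simp [Hgen]
    rintro _ _ (_ | _ | _ | _)
    · rw [map_sub, map_mul, map_mul, map_mul, map_ofNat, hE, hH, two_mul]
      ext1 g; funext k
      simp only [LinearMap.sub_apply, LinearMap.add_apply, Module.End.mul_apply, Pi.sub_apply,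
        Pi.add_apply, opE_apply, opH_apply, taylor_mul, taylor_X, map_neg, map_ofNat]
      ring
    · rw [map_sub, map_mul, map_mul, map_neg, map_mul, map_ofNat, hF, hH, two_mul]
      ext1 g; funext k
      simp only [LinearMap.sub_apply, LinearMap.add_apply, LinearMap.neg_apply,
        Module.End.mul_apply, Pi.sub_apply, Pi.add_apply, Pi.neg_apply, opF_apply, opH_apply,
        taylor_mul, taylor_X, map_ofNat]
      ring
    · rw [← aeval_algHom_apply, map_mul, map_sub, map_one, hE, hF, hH]
      ext1 g; funext k
      have := aeval_opH_add P (-1) g k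
      rw [map_neg, map_one, ← sub_eq_add_neg] at this
      rw [this]
      simp [taylor_taylor]
      norm_num
    · rw [← aeval_algHom_apply, map_mul, map_add, map_one, hE, hF, hH]
      ext1 g; funext k
      have := aeval_opH_add P 1 g k
      rw [map_one] at this
      rw [this]
      simp [taylor_taylor]⟩

theorem rep_eA (P : ℂ[X]) : rep P (eA P) = opE := by
  simp [rep, eA, Egen, RingQuot.liftAlgHom_mkAlgHom_apply]

theorem rep_fA (P : ℂ[X]) : rep P (fA P) = opF P := by
  simp [rep, fA, Fgen, RingQuot.liftAlgHom_mkAlgHom_apply]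

theorem rep_hA (P : ℂ[X]) : rep P (hA P) = opH := by
  simp [rep, hA, Hgen, RingQuot.liftAlgHom_mkAlgHom_apply]

theorem rep_hEval (P R : ℂ[X]) (g : ℤ → ℂ[X]) (k : ℤ) : rep P (hEval P R) g k = R * g k := by
  have := aeval_opH_add R 0 g k
  rw [map_zero, add_zero, taylor_zero] at this
  rw [← this, hEval, ← aeval_algHom_apply, rep_hA]

/-- The functional on `𝒜(P)` vanishing on nonzero weights and equal to `T₀` on `ℂ[h]`. -/
def trFun (P : ℂ[X]) (T₀ : ℂ[X] →ₗ[ℂ] ℂ) : AP P →ₗ[ℂ] ℂ where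
  toFun a := T₀ (rep P a (Pi.single 0 1) 0)
  map_add' a b := by simp
  map_smul' c a := by simp

theorem trFun_hEval (P : ℂ[X]) (T₀ : ℂ[X] →ₗ[ℂ] ℂ) (R : ℂ[X]) :
    trFun P T₀ (hEval P R) = T₀ R := by
  simp [trFun, rep_hEval]

theorem trFun_eq_zero {P : ℂ[X]} (T₀ : ℂ[X] →ₗ[ℂ] ℂ) {k : ℤ} (hk : k ≠ 0) {a : AP P}
    (ha : a ∈ wtSpace P k) : trFun P T₀ a = 0 := by
  have hE (n : ℕ) (m : ℤ) (g : ℤ → ℂ[X]) (hg : ∀ j ≠ m, g j = 0) :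
      ∀ j ≠ m + n, (opE ^ n) g j = 0 := by
    induction n with
    | zero => simpa using hg
    | succ n ih =>
      intro j hj
      rw [pow_succ', Module.End.mul_apply, opE_apply, ih _ (by push_cast at hj; omega), map_zero]
  have hF (n : ℕ) (m : ℤ) (g : ℤ → ℂ[X]) (hg : ∀ j ≠ m, g j = 0) :
      ∀ j ≠ m - n, (opF P ^ n) g j = 0 := by
    induction n with
    | zero => simpa using hg
    | succ n ih =>
      intro j hj
      rw [pow_succ', Module.End.mul_apply, opF_apply, ih _ (by push_cast at hj; omega), map_zero,
        mul_zero]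
  obtain ⟨R, rfl⟩ := mem_wtSpace.1 ha
  change T₀ (rep P (hEval P R * wtGen P k) (Pi.single 0 1) 0) = 0
  rw [map_mul (rep P), Module.End.mul_apply, rep_hEval, wtGen, map_mul (rep P), map_pow,
    map_pow, rep_eA, rep_fA, Module.End.mul_apply,
    hE _ _ _ (hF _ 0 _ fun j hj => Pi.single_eq_of_ne hj _) _ (by omega),
    mul_zero, map_zero]

theorem trFun_mul_comm_of_wt {P : ℂ[X]} (T₀ : ℂ[X] →ₗ[ℂ] ℂ) {m : ℤ} {g : AP P}
    (hg : g ∈ wtSpace P m) (h : ∀ b ∈ wtSpace P (-m), trFun P T₀ (g * b) = trFun P T₀ (b * g))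
    (b : AP P) : trFun P T₀ (g * b) = trFun P T₀ (b * g) := by
  obtain ⟨s, c, hc, rfl⟩ := exists_sum_wtSpace b
  rw [Finset.mul_sum, Finset.sum_mul, map_sum, map_sum]
  refine Finset.sum_congr rfl fun k _ => ?_
  by_cases hk : k = -m
  · exact h _ (hk ▸ hc k)
  · rw [trFun_eq_zero T₀ (by omega) (mul_mem_wtSpace hg (hc k)),
      trFun_eq_zero T₀ (by omega) (mul_mem_wtSpace (hc k) hg)]

theorem trFun_mul_comm {P : ℂ[X]} {T₀ U₀ : ℂ[X] →ₗ[ℂ] ℂ}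
    (h1 : ∀ F, T₀ (taylor (-1) (F * P)) = U₀ F) (h2 : ∀ F, T₀ (taylor 1 (F * P)) = U₀ F)
    (a b : AP P) : trFun P T₀ (a * b) = trFun P T₀ (b * a) := by
  induction a using AP.induction generalizing b with
  | scalar r => rw [Algebra.commutes]
  | add x y hx hy => rw [add_mul, mul_add, map_add, map_add, hx, hy]
  | mul x y hx hy => rw [mul_assoc, hx, mul_assoc, hy, mul_assoc]
  | h =>
    refine trFun_mul_comm_of_wt T₀ (hA_mem P) (fun b hb => ?_) b
    obtain ⟨R, rfl⟩ := mem_wtSpace_zero (by simpa using hb)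
    have : hA P = hEval P X := by simp [hEval]
    rw [this, ← map_mul, ← map_mul, mul_comm]
  | e =>
    refine trFun_mul_comm_of_wt T₀ (eA_mem P) (fun b hb => ?_) b
    obtain ⟨R, rfl⟩ := mem_wtSpace_neg_one hb
    rw [← mul_assoc, eA_mul_hEval, mul_assoc, mul_assoc, fA_mul_eA, eA_mul_fA, ← map_mul,
      ← map_mul, trFun_hEval, trFun_hEval]
    have e1 := h1 (taylor (-1) R)
    have e2 := h2 (taylor (-1) R)
    rw [taylor_mul, taylor_taylor] at e1 e2
    norm_num at e1 e2
    rw [e1, e2]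
  | f =>
    refine trFun_mul_comm_of_wt T₀ (fA_mem P) (fun b hb => ?_) b
    obtain ⟨R, rfl⟩ := mem_wtSpace_one (by simpa using hb)
    rw [← mul_assoc, fA_mul_hEval, mul_assoc, mul_assoc, fA_mul_eA, eA_mul_fA, ← map_mul,
      ← map_mul, trFun_hEval, trFun_hEval]
    have e1 := h1 (taylor 1 R)
    have e2 := h2 (taylor 1 R)
    rw [taylor_mul, taylor_taylor] at e1 e2
    norm_num at e1 e2
    rw [e1, e2]

/-- The antilinear involution `R ↦ R̄(-x)` of `ℂ[x]`. -/
def pstar : ℂ[X] →+* ℂ[X] := (compRingHom (-X)).comp (mapRingHom (starRingEnd ℂ))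

theorem eval_pstar (R : ℂ[X]) (y : ℂ) :
    (pstar R).eval y = starRingEnd ℂ (R.eval (-starRingEnd ℂ y)) := by
  have : (-y) = starRingEnd ℂ (-starRingEnd ℂ y) := by simp
  simp only [pstar, RingHom.comp_apply, coe_compRingHom_apply, coe_mapRingHom, eval_comp, eval_neg,
    eval_X]
  rw [this, eval_map, eval₂_at_apply]

theorem pstar_taylor {s : ℂ} (hs : starRingEnd ℂ s = s) (R : ℂ[X]) :
    pstar (taylor s R) = taylor (-s) (pstar R) :=
  Polynomial.funext fun y => by
    simp [eval_pstar, taylor_eval, hs, add_comm]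

/-- The algebra structure twisted by complex conjugation of the scalars. -/
abbrev conjAlgebra (B : Type*) [Ring B] [Algebra ℂ B] : Algebra ℂ B :=
  ((algebraMap ℂ B).comp (starRingEnd ℂ)).toAlgebra' fun _ _ => Algebra.commutes _ _

/-- The antilinear ring homomorphism from a free algebra with given values on the generators. -/
def conjLift {B : Type*} [Ring B] [Algebra ℂ B] (g : Fin 3 → B) : FA →+* B :=
  @AlgHom.toRingHom ℂ FA B _ _ _ _ (conjAlgebra B)
    (@FreeAlgebra.lift ℂ (Fin 3) _ B _ (conjAlgebra B) g)

theorem conjLift_ι {B : Type*} [Ring B] [Algebra ℂ B] (g : Fin 3 → B) (i : Fin 3) :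
    conjLift g (FreeAlgebra.ι ℂ i) = g i :=
  @FreeAlgebra.lift_ι_apply ℂ (Fin 3) _ B _ (conjAlgebra B) g i

theorem conjLift_algebraMap {B : Type*} [Ring B] [Algebra ℂ B] (g : Fin 3 → B) (c : ℂ) :
    conjLift g (algebraMap ℂ FA c) = algebraMap ℂ B (starRingEnd ℂ c) :=
  @AlgHom.commutes ℂ FA B _ _ _ _ (conjAlgebra B)
    (@FreeAlgebra.lift ℂ (Fin 3) _ B _ (conjAlgebra B) g) c

theorem map_aeval_of_antilinear {A B : Type*} [Ring A] [Algebra ℂ A] [Ring B] [Algebra ℂ B]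
    (φ : A →+* B) (hφ : ∀ c, φ (algebraMap ℂ A c) = algebraMap ℂ B (starRingEnd ℂ c)) (x : A)
    (R : ℂ[X]) : φ (aeval x R) = aeval (-φ x) (pstar R) := by
  have : φ.comp (algebraMap ℂ A) = (algebraMap ℂ B).comp (starRingEnd ℂ) := RingHom.ext hφ
  rw [aeval_def, hom_eval₂, this, ← eval₂_map, ← aeval_def]
  simp [pstar, aeval_comp]

/-- The antilinear involution of `𝒜(P)` with `e ↦ -f`, `f ↦ -e`, `h ↦ -h`. -/
def conjInv {P : ℂ[X]} (hP : pstar P = P) : AP P →+* AP P :=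
  RingQuot.lift ⟨conjLift ![-fA P, -eA P, -hA P], by
    have hE : conjLift ![-fA P, -eA P, -hA P] Egen = -fA P := conjLift_ι _ _
    have hF : conjLift ![-fA P, -eA P, -hA P] Fgen = -eA P := conjLift_ι _ _
    have hH : conjLift ![-fA P, -eA P, -hA P] Hgen = -hA P := conjLift_ι _ _
    rintro _ _ (_ | _ | _ | _)
    · rw [map_sub, map_mul, map_mul, map_mul, map_ofNat, hE, hH, neg_mul_neg, neg_mul_neg,
        hA_mul_fA, mul_sub, mul_two, mul_neg, two_mul]
      abel
    · rw [map_sub, map_mul, map_mul, map_neg, map_mul, map_ofNat, hF, hH, neg_mul_neg, neg_mul_neg,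
        hA_mul_eA, mul_add, mul_two, mul_neg, two_mul]
      abel
    · rw [map_mul, hE, hF, neg_mul_neg, fA_mul_eA,
        map_aeval_of_antilinear _ (conjLift_algebraMap _), map_sub, hH, map_one, hP,
        ← aeval_hA_add, map_one]
      congr 2
      abel
    · rw [map_mul, hE, hF, neg_mul_neg, eA_mul_fA,
        map_aeval_of_antilinear _ (conjLift_algebraMap _), map_add, hH, map_one, hP,
        ← aeval_hA_add, map_neg, map_one]
      congr 2
      abel⟩

section conjInv

variable {P : ℂ[X]} (hP : pstar P = P)

theorem conjInv_mkAlgHom (x : FA) :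
    conjInv hP (RingQuot.mkAlgHom ℂ (ARel P) x) = conjLift ![-fA P, -eA P, -hA P] x := by
  have : RingQuot.mkAlgHom ℂ (ARel P) x = RingQuot.mkRingHom (ARel P) x := by
    rw [← RingQuot.mkAlgHom_coe ℂ]; rfl
  rw [this, conjInv, RingQuot.lift_mkRingHom_apply]

theorem conjInv_eA : conjInv hP (eA P) = -fA P :=
  (conjInv_mkAlgHom hP _).trans (conjLift_ι _ _)

theorem conjInv_fA : conjInv hP (fA P) = -eA P :=
  (conjInv_mkAlgHom hP _).trans (conjLift_ι _ _)

theorem conjInv_hA : conjInv hP (hA P) = -hA P :=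
  (conjInv_mkAlgHom hP _).trans (conjLift_ι _ _)

theorem conjInv_algebraMap (c : ℂ) :
    conjInv hP (algebraMap ℂ _ c) = algebraMap ℂ _ (starRingEnd ℂ c) := by
  rw [← (RingQuot.mkAlgHom ℂ (ARel P)).commutes, conjInv_mkAlgHom, conjLift_algebraMap]

theorem conjInv_hEval (R : ℂ[X]) : conjInv hP (hEval P R) = hEval P (pstar R) := by
  rw [hEval, map_aeval_of_antilinear _ (conjInv_algebraMap hP), conjInv_hA, neg_neg]

theorem conjInv_conjInv (a : AP P) : conjInv hP (conjInv hP a) = a := by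
  induction a using AP.induction with
  | scalar r => simp [conjInv_algebraMap]
  | e => simp [conjInv_eA, conjInv_fA]
  | f => simp [conjInv_eA, conjInv_fA]
  | h => simp [conjInv_hA]
  | mul a b ha hb => simp [ha, hb]
  | add a b ha hb => simp [ha, hb]

theorem pow_mem_wtSpace {k : ℤ} {a : AP P} (ha : a ∈ wtSpace P k) (n : ℕ) :
    a ^ n ∈ wtSpace P (n * k) := by
  induction n with
  | zero => simpa using hEval_mem P 1
  | succ n ih =>
    rw [pow_succ, show ((n + 1 : ℕ) * k : ℤ) = n * k + k by push_cast; ring]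
    exact mul_mem_wtSpace ih ha

theorem conjInv_mem {k : ℤ} {a : AP P} (ha : a ∈ wtSpace P k) :
    conjInv hP a ∈ wtSpace P (-k) := by
  obtain ⟨R, rfl⟩ := mem_wtSpace.1 ha
  rw [map_mul, conjInv_hEval, wtGen, map_mul, map_pow, map_pow, conjInv_eA, conjInv_fA]
  have := hEval_mul_mem (pstar R) (mul_mem_wtSpace (pow_mem_wtSpace (neg_mem (fA_mem P)) k.toNat)
    (pow_mem_wtSpace (neg_mem (eA_mem P)) (-k).toNat))
  rwa [show (k.toNat * (-1) + (-k).toNat * 1 : ℤ) = -k by omega] at this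

theorem trFun_conjInv {T₀ : ℂ[X] →ₗ[ℂ] ℂ} (hc : ∀ R, T₀ (pstar R) = starRingEnd ℂ (T₀ R))
    (a : AP P) : trFun P T₀ (conjInv hP a) = starRingEnd ℂ (trFun P T₀ a) := by
  obtain ⟨s, c, hcs, rfl⟩ := exists_sum_wtSpace a
  simp only [map_sum]
  refine Finset.sum_congr rfl fun k _ => ?_
  by_cases hk : k = 0
  · subst hk
    obtain ⟨R, hR⟩ := mem_wtSpace_zero (hcs 0)
    rw [hR, conjInv_hEval, trFun_hEval, trFun_hEval, hc]
  · rw [trFun_eq_zero T₀ hk (hcs k),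
      trFun_eq_zero T₀ (neg_ne_zero.2 hk) (conjInv_mem hP (hcs k)), map_zero]

end conjInv

theorem trFun_diag_pos {P : ℂ[X]} (hP : pstar P = P) (hP0 : P ≠ 0) {T₀ U₀ : ℂ[X] →ₗ[ℂ] ℂ}
    (htr : ∀ a b, trFun P T₀ (a * b) = trFun P T₀ (b * a))
    (hT : ∀ R ≠ 0, ∃ r : ℝ, 0 < r ∧ T₀ (R * pstar R) = r)
    (hU : ∀ R ≠ 0, ∃ r : ℝ, 0 < r ∧ -U₀ (R * pstar R) = r)
    {s : ℂ} (hs : starRingEnd ℂ s = s) {a b : AP P}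
    (hab : ∀ R, a * hEval P R * b = hEval P (taylor (-2 * s) R * taylor (-s) P))
    (hba : ∀ R, b * hEval P R * a = hEval P (taylor (2 * s) R * taylor s P))
    (hTU : ∀ F, T₀ (taylor (-s) (F * P)) = U₀ F) (k : ℕ) : ∀ R : ℂ[X], R ≠ 0 →
      ∃ r : ℝ, 0 < r ∧ trFun P T₀ (hEval P R * a ^ k * (hEval P (pstar R) * (-b) ^ k)) = r := by
  induction k using Nat.twoStepInduction with
  | zero =>
    intro R hR
    simpa [← map_mul, trFun_hEval] using hT R hR
  | one =>
    intro R hR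
    have h0 : taylor s R ≠ 0 := fun h => hR ((taylor_eq_zero s R).1 h)
    obtain ⟨r, hr, h⟩ := hU _ h0
    refine ⟨r, hr, ?_⟩
    rw [← h, ← hTU, pstar_taylor hs, taylor_mul, taylor_mul, taylor_taylor, taylor_taylor,
      neg_add_cancel, taylor_zero, pow_one, pow_one, mul_neg, mul_neg, map_neg, mul_assoc,
      ← mul_assoc a, hab, ← map_mul, trFun_hEval, mul_assoc,
      show -2 * s = -s + -s by ring]
  | more k ih _ =>
    intro R hR
    have h0 : taylor (2 * s) R * taylor s P ≠ 0 :=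
      mul_ne_zero (fun h => hR ((taylor_eq_zero _ R).1 h)) (fun h => hP0 ((taylor_eq_zero s P).1 h))
    obtain ⟨r, hr, h⟩ := ih _ h0
    refine ⟨r, hr, ?_⟩
    have hs2 : starRingEnd ℂ (2 * s) = 2 * s := by rw [map_mul, hs, map_ofNat]
    rw [← h, map_mul pstar, pstar_taylor hs, pstar_taylor hs2, hP, ← neg_mul, ← hba, ← hab]
    calc trFun P T₀ (hEval P R * a ^ (k + 2) * (hEval P (pstar R) * (-b) ^ (k + 2)))
        = trFun P T₀ ((hEval P R * a * a ^ k * (a * hEval P (pstar R) * b * (-b) ^ k)) * b) := by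
          rw [pow_succ' (-b), pow_succ (-b), pow_succ a, pow_succ' a]
          simp only [mul_assoc, mul_neg, neg_mul, neg_neg]
      _ = _ := by
          rw [htr]
          simp only [mul_assoc]

theorem unitarizable_of_functionals {P : ℂ[X]} (hP : pstar P = P) (hP0 : P ≠ 0)
    {T₀ U₀ : ℂ[X] →ₗ[ℂ] ℂ}
    (h1 : ∀ F, T₀ (taylor (-1) (F * P)) = U₀ F) (h2 : ∀ F, T₀ (taylor 1 (F * P)) = U₀ F)
    (hc : ∀ R, T₀ (pstar R) = starRingEnd ℂ (T₀ R))
    (hT : ∀ R ≠ 0, ∃ r : ℝ, 0 < r ∧ T₀ (R * pstar R) = r)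
    (hU : ∀ R ≠ 0, ∃ r : ℝ, 0 < r ∧ -U₀ (R * pstar R) = r) : Unitarizable P := by
  have htr := trFun_mul_comm h1 h2
  refine ⟨⟨fun u v => trFun P T₀ (u * conjInv hP v), ?_, ?_, ?_, ?_, ?_, ?_, ?_, ?_, ?_⟩, ?_⟩
  · intro u v w; rw [add_mul, map_add]
  · intro c u v; rw [smul_mul_assoc, map_smul, smul_eq_mul]
  · intro u v
    rw [← trFun_conjInv hP hc, map_mul (conjInv hP), conjInv_conjInv, htr]
  · intro u v
    rw [mul_assoc, htr, map_mul (conjInv hP), conjInv_fA, mul_neg, mul_neg, map_neg, neg_neg,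
      mul_assoc]
  · intro u v
    rw [mul_assoc, htr, map_mul (conjInv hP), conjInv_hA, mul_neg, mul_neg, map_neg, neg_neg,
      mul_assoc]
  · intro u v
    rw [mul_assoc, htr, map_mul (conjInv hP), conjInv_eA, mul_neg, mul_neg, map_neg, neg_neg,
      mul_assoc]
  · intro u v
    rw [map_mul (conjInv hP), conjInv_fA, neg_mul, mul_neg, map_neg, neg_neg,
      mul_assoc]
  · intro u v
    rw [map_mul (conjInv hP), conjInv_hA, neg_mul, mul_neg, map_neg, neg_neg,
      mul_assoc]
  · intro u v
    rw [map_mul (conjInv hP), conjInv_eA, neg_mul, mul_neg, map_neg, neg_neg,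
      mul_assoc]
  · intro u hu
    obtain ⟨s, c, hcs, rfl⟩ := exists_sum_wtSpace u
    have hpos (k : ℤ) (h0 : c k ≠ 0) :
        ∃ r : ℝ, 0 < r ∧ trFun P T₀ (c k * conjInv hP (c k)) = r := by
      obtain ⟨R, hR⟩ := mem_wtSpace.1 (hcs k)
      have hR0 : R ≠ 0 := by rintro rfl; simp [← hR] at h0
      rcases le_total 0 k with hk | hk
      · lift k to ℕ using hk
        rw [← hR, map_mul (conjInv hP), conjInv_hEval]
        simp only [wtGen, Int.toNat_natCast, Int.toNat_neg_natCast, pow_zero, mul_one, map_pow,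
          conjInv_eA]
        refine trFun_diag_pos hP hP0 htr hT hU (s := 1) (by simp) (fun S => ?_) (fun S => ?_)
          h1 k R hR0
        · rw [eA_mul_hEval, mul_assoc, eA_mul_fA, map_mul, mul_one]
        · rw [fA_mul_hEval, mul_assoc, fA_mul_eA, map_mul, mul_one]
      · obtain ⟨j, rfl⟩ : ∃ j : ℕ, k = -(j : ℤ) := ⟨(-k).toNat, by omega⟩
        rw [← hR, map_mul (conjInv hP), conjInv_hEval]
        simp only [wtGen, neg_neg, Int.toNat_natCast, Int.toNat_neg_natCast, pow_zero, one_mul,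
          map_pow, conjInv_fA]
        refine trFun_diag_pos hP hP0 htr hT hU (s := -1) (by simp) (fun S => ?_) (fun S => ?_)
          (fun F => by rw [neg_neg, h2]) j R hR0
        · rw [fA_mul_hEval, mul_assoc, fA_mul_eA, map_mul, neg_mul_neg, mul_one, neg_neg]
        · rw [eA_mul_hEval, mul_assoc, eA_mul_fA, map_mul, mul_neg_one]
    have hpos' (k : ℤ) : ∃ r : ℝ, 0 ≤ r ∧ (c k ≠ 0 → 0 < r) ∧
        trFun P T₀ (c k * conjInv hP (c k)) = r := by
      by_cases h0 : c k = 0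
      · exact ⟨0, le_rfl, fun h => absurd h0 h, by simp [h0]⟩
      · obtain ⟨r, hr, h⟩ := hpos k h0
        exact ⟨r, hr.le, fun _ => hr, h⟩
    choose r hr0 hr hrT using hpos'
    obtain ⟨k, hks, hk⟩ := Finset.exists_ne_zero_of_sum_ne_zero hu
    refine ⟨∑ k ∈ s, r k, Finset.sum_pos' (fun k _ => hr0 k) ⟨k, hks, hr k hk⟩, ?_⟩
    simp only [map_sum, Finset.sum_mul, Finset.mul_sum, Complex.ofReal_sum]
    refine Finset.sum_congr rfl fun k hk => ?_
    rw [← hrT, Finset.sum_eq_single_of_mem k hk]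
    intro l _ hl
    exact trFun_eq_zero T₀ (by omega) (mul_mem_wtSpace (hcs _) (conjInv_mem hP (hcs _)))

theorem exists_eval_bound (p : ℂ[X]) :
    ∃ C, ∀ y : ℂ, |y.re| ≤ 1 → ‖p.eval y‖ ≤ C * Real.exp |y.im| := by
  induction p using Polynomial.induction_on' with
  | add p q hp hq =>
    obtain ⟨C, hC⟩ := hp
    obtain ⟨D, hD⟩ := hq
    refine ⟨C + D, fun y hy => ?_⟩
    rw [eval_add, add_mul]
    exact (norm_add_le _ _).trans (add_le_add (hC y hy) (hD y hy))
  | monomial n a =>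
    refine ⟨‖a‖ * (n.factorial * Real.exp 1), fun y hy => ?_⟩
    rw [eval_monomial, norm_mul, norm_pow, mul_assoc, mul_assoc, ← Real.exp_add]
    refine mul_le_mul_of_nonneg_left ?_ (norm_nonneg a)
    have h1 : ‖y‖ ≤ 1 + |y.im| := (Complex.norm_le_abs_re_add_abs_im y).trans (by linarith)
    have h2 := Real.pow_div_factorial_le_exp (1 + |y.im|) (by positivity) n
    rw [div_le_iff₀ (by positivity), mul_comm] at h2
    exact (pow_le_pow_left₀ (norm_nonneg y) h1 n).trans h2

theorem integrable_exp_neg_abs : MeasureTheory.Integrable fun t : ℝ => Real.exp (-|t|) := by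
  rw [← MeasureTheory.integrableOn_univ, ← Set.Iic_union_Ioi (a := (0 : ℝ))]
  refine ((integrableOn_exp_Iic 0).congr_fun (fun t ht => ?_) measurableSet_Iic).union
    ((integrableOn_exp_neg_Ioi 0).congr_fun (fun t ht => ?_) measurableSet_Ioi)
  · simp [abs_of_nonpos (Set.mem_Iic.1 ht)]
  · simp [abs_of_pos (Set.mem_Ioi.1 ht)]

theorem integrable_of_norm_le_exp {g : ℝ → ℂ} (hg : Continuous g) {C : ℝ}
    (h : ∀ t, ‖g t‖ ≤ C * Real.exp (-|t|)) : MeasureTheory.Integrable g :=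
  ((integrable_exp_neg_abs).const_mul C).mono' hg.aestronglyMeasurable
    (Filter.Eventually.of_forall h)

/-- Shift of a vertical contour of integration. -/
theorem integral_vertical_shift {g : ℂ → ℂ} {C : ℝ}
    (hg : ∀ y : ℂ, |y.re| ≤ 1 → DifferentiableAt ℂ g y)
    (hb : ∀ y : ℂ, |y.re| ≤ 1 → ‖g y‖ ≤ C * Real.exp (-|y.im|)) {s : ℝ} (hs : |s| ≤ 1) :
    ∫ t : ℝ, g (s + t * Complex.I) = ∫ t : ℝ, g (t * Complex.I) := by
  have hint (s : ℝ) (hs : |s| ≤ 1) :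
      MeasureTheory.Integrable fun t : ℝ => g (s + t * Complex.I) := by
    refine integrable_of_norm_le_exp (C := C) ?_ fun t => ?_
    · refine continuous_iff_continuousAt.2 fun t => ?_
      exact ContinuousAt.comp (f := fun t : ℝ => (s + t * Complex.I : ℂ))
        (hg _ (by simpa using hs)).continuousAt (by fun_prop)
    · simpa using hb (s + t * Complex.I) (by simpa using hs)
  have hlim (s : ℝ) (hs : |s| ≤ 1) :=
    MeasureTheory.intervalIntegral_tendsto_integral (hint s hs)
      (Filter.tendsto_neg_atTop_atBot) Filter.tendsto_id
  have hd := (hlim s hs).sub (hlim 0 (by simp))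
  have hseg (x : ℝ) (hx : x ∈ Set.uIcc 0 s) : |x| ≤ 1 := by
    rcases Set.mem_uIcc.1 hx with h | h <;> rw [abs_le] at hs ⊢ <;> constructor <;> linarith
  have hz : Filter.Tendsto (fun T : ℝ => (∫ t in -T..T, g (s + t * Complex.I)) -
      ∫ t in -T..T, g ((0 : ℝ) + t * Complex.I)) Filter.atTop (nhds 0) := by
    have hexp : Filter.Tendsto (fun T : ℝ => 2 * (C * Real.exp (-|T|) * |s|)) Filter.atTop
        (nhds 0) := by
      have := (((Real.tendsto_exp_neg_atTop_nhds_zero.comp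
        Filter.tendsto_abs_atTop_atTop).const_mul C).mul_const |s|).const_mul 2
      simpa using this
    refine squeeze_zero_norm (fun T => ?_) hexp
    have hrect := Complex.integral_boundary_rect_eq_zero_of_differentiableOn g
      (⟨0, -T⟩ : ℂ) (⟨s, T⟩ : ℂ) (fun y hy => (hg y (hseg _ hy.1)).differentiableWithinAt)
    simp only [smul_eq_mul] at hrect
    have hh (T' : ℝ) (hT : |T'| = |T|) :
        ‖∫ x in (0 : ℝ)..s, g (x + T' * Complex.I)‖ ≤ C * Real.exp (-|T|) * |s| := by
      have := intervalIntegral.norm_integral_le_of_norm_le_const (a := 0) (b := s)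
        (f := fun x : ℝ => g (x + T' * Complex.I)) (C := C * Real.exp (-|T|)) fun x hx => by
          have hx' := hseg x (Set.uIoc_subset_uIcc hx)
          simpa [hT] using hb (x + T' * Complex.I) (by simpa using hx')
      simpa using this
    have e : (∫ t in -T..T, g (s + t * Complex.I)) - ∫ t in -T..T, g ((0 : ℝ) + t * Complex.I)
        = Complex.I * ((∫ x in (0 : ℝ)..s, g (x + (-T : ℝ) * Complex.I)) -
          ∫ x in (0 : ℝ)..s, g (x + T * Complex.I)) := by
      linear_combination (-Complex.I) * hrect + ((∫ t in -T..T, g (s + t * Complex.I)) -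
        ∫ t in -T..T, g ((0 : ℝ) + t * Complex.I)) * Complex.I_sq
    rw [e, norm_mul, Complex.norm_I, one_mul, two_mul]
    exact (norm_sub_le _ _).trans (add_le_add (hh _ (abs_neg T)) (hh _ rfl))
  have := tendsto_nhds_unique hd hz
  rw [sub_eq_zero] at this
  simpa using this

theorem integrable_eval_mul {v : ℝ → ℝ} (hv : Continuous v) {C : ℝ}
    (hC : ∀ t, |v t| ≤ C * Real.exp (-(2 * |t|))) (R : ℂ[X]) :
    MeasureTheory.Integrable fun t : ℝ => R.eval (t * Complex.I) * v t := by
  obtain ⟨D, hD⟩ := exists_eval_bound R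
  refine integrable_of_norm_le_exp (C := D * C) (by fun_prop) fun t => ?_
  have h1 : ‖R.eval (t * Complex.I)‖ ≤ D * Real.exp |t| := by
    simpa using hD (t * Complex.I) (by simp)
  rw [norm_mul, Complex.norm_real, Real.norm_eq_abs]
  refine (mul_le_mul h1 (hC t) (abs_nonneg _) ((norm_nonneg _).trans h1)).trans_eq ?_
  rw [mul_mul_mul_comm, ← Real.exp_add]
  ring_nf

/-- Integration over the imaginary axis against a rapidly decaying weight. -/
def lineFun (v : ℝ → ℝ) (hv : Continuous v) (C : ℝ)
    (hC : ∀ t, |v t| ≤ C * Real.exp (-(2 * |t|))) : ℂ[X] →ₗ[ℂ] ℂ where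
  toFun R := ∫ t : ℝ, R.eval (t * Complex.I) * v t
  map_add' R S := by
    simp only [eval_add, add_mul]
    exact MeasureTheory.integral_add (integrable_eval_mul hv hC R) (integrable_eval_mul hv hC S)
  map_smul' c R := by
    simp only [eval_smul, smul_eq_mul, mul_assoc, RingHom.id_apply]
    exact MeasureTheory.integral_const_mul _ _

theorem lineFun_apply {v : ℝ → ℝ} (hv : Continuous v) {C : ℝ}
    (hC : ∀ t, |v t| ≤ C * Real.exp (-(2 * |t|))) (R : ℂ[X]) :
    lineFun v hv C hC R = ∫ t : ℝ, R.eval (t * Complex.I) * v t := rfl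

theorem lineFun_pstar {v : ℝ → ℝ} (hv : Continuous v) {C : ℝ}
    (hC : ∀ t, |v t| ≤ C * Real.exp (-(2 * |t|))) (R : ℂ[X]) :
    lineFun v hv C hC (pstar R) = starRingEnd ℂ (lineFun v hv C hC R) := by
  rw [lineFun_apply, lineFun_apply, ← integral_conj]
  simp [eval_pstar]

theorem lineFun_pos {v : ℝ → ℝ} (hv : Continuous v) {C : ℝ}
    (hC : ∀ t, |v t| ≤ C * Real.exp (-(2 * |t|))) (h0 : ∀ t, 0 < v t) (R : ℂ[X]) (hR : R ≠ 0) :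
    ∃ r : ℝ, 0 < r ∧ lineFun v hv C hC (R * pstar R) = r := by
  have e (t : ℝ) : (R * pstar R).eval (t * Complex.I) * v t
      = ((‖R.eval (t * Complex.I)‖ ^ 2 * v t : ℝ) : ℂ) := by
    simp [eval_pstar, Complex.mul_conj']
  have hint := integrable_eval_mul hv hC (R * pstar R)
  simp only [e] at hint
  refine ⟨∫ t : ℝ, ‖R.eval (t * Complex.I)‖ ^ 2 * v t, ?_, ?_⟩
  · obtain ⟨t, ht⟩ : ∃ t : ℝ, R.eval (t * Complex.I) ≠ 0 := by
      by_contra! h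
      refine hR (eq_zero_of_infinite_isRoot R (Set.Infinite.mono (s := Set.range fun t : ℝ =>
        (t * Complex.I : ℂ)) ?_ (Set.infinite_range_of_injective fun s t hst => ?_)))
      · rintro _ ⟨t, rfl⟩; exact h t
      · simpa using hst
    refine MeasureTheory.integral_pos_of_integrable_nonneg_nonzero (x := t) (by fun_prop)
      (by exact_mod_cast hint.re) (fun t => mul_nonneg (by positivity) (h0 t).le) ?_
    exact mul_ne_zero (pow_ne_zero 2 (norm_ne_zero_iff.2 ht)) (h0 t).ne'
  · rw [lineFun_apply, ← integral_complex_ofReal]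
    simp only [e]

theorem unitarizable_of_weight {P : ℂ[X]} (hP : pstar P = P) (hP0 : P ≠ 0) {N : ℂ → ℂ}
    {w κ : ℝ → ℝ} {C : ℝ}
    (hN : ∀ y : ℂ, |y.re| ≤ 1 → DifferentiableAt ℂ N y)
    (hNb : ∀ y : ℂ, |y.re| ≤ 1 → ‖N y‖ ≤ C * Real.exp (-(2 * |y.im|)))
    (hw : Continuous w) (hw0 : ∀ t, 0 < w t) (hwb : ∀ t, |w t| ≤ C * Real.exp (-(2 * |t|)))
    (hNw : ∀ s : ℝ, |s| = 1 → ∀ t : ℝ,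
      N (s + t * Complex.I) = P.eval (s + t * Complex.I) * w t)
    (hκ : ∀ t : ℝ, N (t * Complex.I) = -κ t) (hκ0 : ∀ t, 0 < κ t) :
    Unitarizable P := by
  have hκc : Continuous κ := by
    have : κ = fun t : ℝ => (-N (t * Complex.I)).re := by ext t; simp [hκ]
    rw [this]
    refine Complex.continuous_re.comp (continuous_iff_continuousAt.2 fun t => ?_)
    exact (ContinuousAt.comp (f := fun t : ℝ => (t * Complex.I : ℂ))
        (hN _ (by simp)).continuousAt (by fun_prop)).neg
  have hκb (t : ℝ) : |κ t| ≤ C * Real.exp (-(2 * |t|)) := by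
    simpa [hκ] using hNb (t * Complex.I) (by simp)
  have shift (F : ℂ[X]) (s : ℝ) (hs : |s| = 1) :
      lineFun w hw C hwb (taylor (s : ℂ) (F * P)) = -lineFun κ hκc C hκb F := by
    obtain ⟨D, hD⟩ := exists_eval_bound F
    have := integral_vertical_shift (g := fun y => F.eval y * N y) (C := D * C)
      (fun y hy => (F.differentiable y).mul (hN y hy)) (fun y hy => by
        rw [norm_mul]
        refine (mul_le_mul (hD y hy) (hNb y hy) (norm_nonneg _)
          ((norm_nonneg _).trans (hD y hy))).trans_eq ?_
        rw [mul_mul_mul_comm, ← Real.exp_add]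
        ring_nf) hs.le
    simp only [hκ, hNw s hs, mul_neg, MeasureTheory.integral_neg] at this
    rw [lineFun_apply, lineFun_apply, ← this]
    simp only [taylor_eval, eval_mul, add_comm (s : ℂ), mul_assoc]
  refine unitarizable_of_functionals hP hP0 (T₀ := lineFun w hw C hwb)
    (U₀ := -lineFun κ hκc C hκb) (fun F => ?_) (fun F => ?_) (lineFun_pstar hw hwb)
    (lineFun_pos hw hwb hw0) ?_
  · simpa using shift F (-1) (by simp)
  · simpa using shift F 1 (by simp)
  · simpa using lineFun_pos hκc hκb hκ0

/-- The exponential `y ↦ e^{πiy}`. -/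
def expPi (y : ℂ) : ℂ := Complex.exp (Real.pi * y * Complex.I)

theorem differentiable_expPi : Differentiable ℂ expPi := by
  unfold expPi; fun_prop

theorem expPi_ne_zero (y : ℂ) : expPi y ≠ 0 := Complex.exp_ne_zero _

theorem norm_expPi (y : ℂ) : ‖expPi y‖ = Real.exp (-(Real.pi * y.im)) := by
  simp [expPi, Complex.norm_exp]

theorem expPi_mul_I (t : ℝ) : expPi (t * Complex.I) = (Real.exp (-(Real.pi * t)) : ℝ) := by
  rw [expPi, Complex.ofReal_exp]
  congr 1
  push_cast
  linear_combination (Real.pi * t : ℂ) * Complex.I_sq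

theorem expPi_add_mul_I {s : ℝ} (hs : |s| = 1) (t : ℝ) :
    expPi (s + t * Complex.I) = (-Real.exp (-(Real.pi * t)) : ℝ) := by
  have : expPi (s + t * Complex.I) = expPi s * expPi (t * Complex.I) := by
    rw [expPi, expPi, expPi, ← Complex.exp_add]; ring_nf
  rw [this, expPi_mul_I]
  have : expPi s = -1 := by
    rcases eq_or_eq_neg_of_abs_eq hs with rfl | rfl
    · simp [expPi]
    · simp [expPi, Complex.exp_neg]
  simp [this]

theorem expPi_neg_conj (y : ℂ) : expPi (-starRingEnd ℂ y) = starRingEnd ℂ (expPi y) := by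
  rw [expPi, expPi, ← Complex.exp_conj]
  simp

theorem eq_of_expPi_eq {y z : ℂ} (h : expPi y = expPi z) (hyz : |y.re - z.re| < 2) : y = z := by
  obtain ⟨n, hn⟩ := Complex.exp_eq_exp_iff_exists_int.1 h
  have hpi : (Real.pi : ℂ) ≠ 0 := by exact_mod_cast Real.pi_ne_zero
  have h1 : y = z + 2 * n := by
    refine mul_left_cancel₀ (mul_ne_zero hpi Complex.I_ne_zero) ?_
    linear_combination hn
  have h2 : y.re - z.re = 2 * n := by rw [h1]; simp
  have h3 : n = 0 := by
    rw [h2, abs_lt] at hyz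
    have a : (-1 : ℝ) < n := by linarith
    have b : (n : ℝ) < 1 := by linarith
    norm_cast at a b
    omega
  simp [h1, h3]

theorem exists_sub_eq_mul_expPi_sub {α : ℂ} (hα : |α.re| < 1) : ∃ D : ℂ → ℂ,
    ∀ y : ℂ, |y.re| ≤ 1 → DifferentiableAt ℂ D y ∧ D y ≠ 0 ∧
      y - α = D y * (expPi y - expPi α) := by
  have hd : Differentiable ℂ (dslope expPi α) := by
    rw [← differentiableOn_univ, Complex.differentiableOn_dslope Filter.univ_mem]
    exact differentiable_expPi.differentiableOn
  have hs (y : ℂ) : (y - α) * dslope expPi α y = expPi y - expPi α := sub_smul_dslope expPi α y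
  have h0 (y : ℂ) (hy : |y.re| ≤ 1) : dslope expPi α y ≠ 0 := by
    intro h
    by_cases hya : y = α
    · subst hya
      rw [dslope_same] at h
      have : HasDerivAt expPi (expPi y * (Real.pi * Complex.I)) y := by
        have := (((hasDerivAt_id y).const_mul (Real.pi : ℂ)).mul_const Complex.I).cexp
        simp only [id_eq, mul_one] at this
        exact this
      rw [this.deriv] at h
      simp [expPi_ne_zero, Real.pi_ne_zero] at h
    · have := hs y
      rw [h, mul_zero] at this
      refine hya (eq_of_expPi_eq (sub_eq_zero.1 this.symm) ?_)
      rw [abs_le] at hy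
      rw [abs_lt] at hα ⊢
      constructor <;> linarith
  refine ⟨fun y => (dslope expPi α y)⁻¹, fun y hy =>
    ⟨(hd y).inv (h0 y hy), inv_ne_zero (h0 y hy), ?_⟩⟩
  rw [← hs, mul_left_comm, inv_mul_cancel₀ (h0 y hy), mul_one]

theorem exists_prod_sub_eq_mul (S : Multiset ℂ) (hS : ∀ α ∈ S, |α.re| < 1) : ∃ D : ℂ → ℂ,
    ∀ y : ℂ, |y.re| ≤ 1 → DifferentiableAt ℂ D y ∧ D y ≠ 0 ∧
      (S.map fun α => y - α).prod = D y * (S.map fun α => expPi y - expPi α).prod := by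
  induction S using Multiset.induction_on with
  | empty => exact ⟨fun _ => 1, fun y _ => by simp⟩
  | cons α S ih =>
    obtain ⟨D, hD⟩ := ih fun β hβ => hS β (Multiset.mem_cons_of_mem hβ)
    obtain ⟨E, hE⟩ := exists_sub_eq_mul_expPi_sub (hS α (Multiset.mem_cons_self α S))
    refine ⟨fun y => E y * D y, fun y hy => ?_⟩
    obtain ⟨d1, d2, d3⟩ := hD y hy
    obtain ⟨e1, e2, e3⟩ := hE y hy
    refine ⟨e1.mul d1, mul_ne_zero e2 d2, ?_⟩
    rw [Multiset.map_cons, Multiset.map_cons, Multiset.prod_cons, Multiset.prod_cons, d3, e3]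
    ring

/-- The polynomial function with roots `e^{πiα}`, `α ∈ S`. -/
def expProd (S : Multiset ℂ) (z : ℂ) : ℂ := (S.map fun α => z - expPi α).prod

theorem continuous_expProd (S : Multiset ℂ) : Continuous (expProd S) :=
  continuous_multiset_prod S fun _ _ => by fun_prop

theorem expProd_ne_zero {S : Multiset ℂ} {z : ℂ} (h : ∀ α ∈ S, z ≠ expPi α) : expProd S z ≠ 0 := by
  intro h0
  obtain ⟨α, hα, h1⟩ := Multiset.mem_map.1 (Multiset.prod_eq_zero_iff.1 h0)
  exact h α hα (sub_eq_zero.1 h1)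

theorem expProd_neg_exp_ne_zero {S : Multiset ℂ} (hS : ∀ α ∈ S, |α.re| < 1) (t : ℝ) :
    expProd S (-Real.exp (-(Real.pi * t)) : ℝ) ≠ 0 := by
  refine expProd_ne_zero fun α hα h => ?_
  have hα' := hS α hα
  rw [← expPi_add_mul_I abs_one t] at h
  have := congrArg Complex.re (eq_of_expPi_eq h (by
    rw [abs_lt] at hα' ⊢
    constructor <;> simp <;> linarith))
  simp at this
  rw [← this] at hα'
  simp at hα'

theorem conj_expProd {S : Multiset ℂ} (hS : S.map (fun α => -starRingEnd ℂ α) = S) (z : ℂ) :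
    starRingEnd ℂ (expProd S z) = expProd S (starRingEnd ℂ z) := by
  conv_rhs => rw [← hS]
  simp [expProd, map_multiset_prod, Multiset.map_map, expPi_neg_conj]

theorem exists_le_norm_expProd (S : Multiset ℂ) :
    ∃ R, ∀ z : ℂ, R ≤ ‖z‖ → (‖z‖ / 2) ^ S.card ≤ ‖expProd S z‖ := by
  induction S using Multiset.induction_on with
  | empty => exact ⟨0, fun z _ => by simp [expProd]⟩
  | cons α S ih =>
    obtain ⟨R, hR⟩ := ih
    refine ⟨max R (2 * ‖expPi α‖), fun z hz => ?_⟩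
    have h1 := hR z ((le_max_left _ _).trans hz)
    have h2 := (le_max_right _ _).trans hz
    have h3 := norm_sub_norm_le z (expPi α)
    rw [expProd, Multiset.map_cons, Multiset.prod_cons, norm_mul, Multiset.card_cons, pow_succ']
    exact mul_le_mul (by linarith) h1 (by positivity) (norm_nonneg _)

theorem exists_weight_bound (S : Multiset ℂ) {j : ℕ} (hj : 1 ≤ j) (hjS : j + 1 ≤ S.card) :
    ∃ C T : ℝ, 0 ≤ C ∧ ∀ y : ℂ, T ≤ |y.im| → expProd S (expPi y) ≠ 0 ∧
      ‖expPi y ^ j / expProd S (expPi y)‖ ≤ C * Real.exp (-(Real.pi * |y.im|)) := by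
  obtain ⟨R, hR⟩ := exists_le_norm_expProd S
  have h0 : expProd S 0 ≠ 0 := expProd_ne_zero fun α _ h => expPi_ne_zero α h.symm
  have hcont := (continuous_expProd S).continuousAt (x := 0)
  have hev := (hcont.eventually_ne h0).and
    ((hcont.inv₀ h0).norm.eventually_lt (continuousAt_const (y := ‖(expProd S 0)⁻¹‖ + 1))
      (lt_add_one _))
  obtain ⟨δ, hδ, hball⟩ := Metric.eventually_nhds_iff.1 hev
  set M := ‖(expProd S 0)⁻¹‖ + 1
  refine ⟨max (2 ^ S.card) M, max 0 (max (Real.log (max R 1)) (-Real.log (δ / 2))),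
    le_max_of_le_left (by positivity), fun y hy => ?_⟩
  have hy0 := (le_max_right _ _).trans hy
  have hyR := (le_max_left _ _).trans hy0
  have hyδ := (le_max_right _ _).trans hy0
  have hpi : |y.im| ≤ Real.pi * |y.im| :=
    le_mul_of_one_le_left (abs_nonneg _) (by linarith [Real.pi_gt_three])
  rcases le_total y.im 0 with him | him
  · have hz : ‖expPi y‖ = Real.exp (Real.pi * |y.im|) := by
      rw [norm_expPi, abs_of_nonpos him, mul_neg]
    have hRz : max R 1 ≤ ‖expPi y‖ := by
      rw [hz, ← Real.log_le_iff_le_exp (by positivity)]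
      exact hyR.trans hpi
    have hQ := hR _ ((le_max_left _ _).trans hRz)
    have hz1 := (le_max_right _ _).trans hRz
    have hpos : 0 < ‖expProd S (expPi y)‖ := lt_of_lt_of_le (by positivity) hQ
    refine ⟨norm_pos_iff.1 hpos, ?_⟩
    rw [Real.exp_neg, ← hz, norm_div, norm_pow, div_le_iff₀ hpos, ← div_eq_mul_inv]
    calc ‖expPi y‖ ^ j = 2 ^ S.card / ‖expPi y‖ * (‖expPi y‖ ^ (j + 1) / 2 ^ S.card) := by
          field_simp
          ring
      _ ≤ max (2 ^ S.card) M / ‖expPi y‖ * ‖expProd S (expPi y)‖ := by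
          refine mul_le_mul ?_ (le_trans ?_ hQ) (by positivity) (by positivity)
          · gcongr; exact le_max_left _ _
          · rw [div_pow]
            gcongr
  · have hz : ‖expPi y‖ = Real.exp (-(Real.pi * |y.im|)) := by
      rw [norm_expPi, abs_of_nonneg him]
    have hzδ : ‖expPi y‖ < δ := by
      refine lt_of_le_of_lt ?_ (half_lt_self hδ)
      rw [hz, ← Real.le_log_iff_exp_le (by positivity)]
      linarith
    obtain ⟨hne, hlt⟩ := hball (y := expPi y) (by simpa using hzδ)
    refine ⟨hne, ?_⟩
    rw [← hz, div_eq_mul_inv, norm_mul, norm_pow, mul_comm]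
    refine mul_le_mul (hlt.le.trans (le_max_right _ _)) ?_ (by positivity)
      (le_max_of_le_left (by positivity))
    refine pow_le_of_le_one (norm_nonneg _) ?_ (by omega)
    rw [hz, Real.exp_le_one_iff, neg_nonpos]
    positivity

theorem exists_norm_le_exp {Y : Type*} [TopologicalSpace Y] {f : Y → ℂ} {τ : Y → ℝ} {s : Set Y}
    (hf : ContinuousOn f s) (hτ : Continuous τ) {C T : ℝ}
    (hK : IsCompact (s ∩ {y | |τ y| ≤ T}))
    (h : ∀ y ∈ s, T ≤ |τ y| → ‖f y‖ ≤ C * Real.exp (-(2 * |τ y|))) :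
    ∃ C', ∀ y ∈ s, ‖f y‖ ≤ C' * Real.exp (-(2 * |τ y|)) := by
  have hc : ContinuousOn (fun y => ‖f y‖ * Real.exp (2 * |τ y|)) (s ∩ {y | |τ y| ≤ T}) :=
    (hf.norm.mono Set.inter_subset_left).mul (by fun_prop)
  obtain ⟨D, hD⟩ := hK.bddAbove_image hc
  refine ⟨max C D, fun y hy => ?_⟩
  rcases le_total T |τ y| with hT | hT
  · exact (h y hy hT).trans (by gcongr; exact le_max_left _ _)
  · rw [Real.exp_neg, ← div_eq_mul_inv, le_div_iff₀ (Real.exp_pos _)]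
    exact (hD ⟨y, ⟨hy, hT⟩, rfl⟩).trans (le_max_right _ _)

theorem isCompact_strip (T : ℝ) : IsCompact ({y : ℂ | |y.re| ≤ 1} ∩ {y | |y.im| ≤ T}) := by
  refine Metric.isCompact_of_isClosed_isBounded ?_ ?_
  · exact (isClosed_le (by fun_prop) (by fun_prop)).inter (isClosed_le (by fun_prop) (by fun_prop))
  · refine isBounded_iff_forall_norm_le.2 ⟨1 + T, fun y hy => ?_⟩
    exact (Complex.norm_le_abs_re_add_abs_im y).trans (add_le_add hy.1 hy.2)

theorem forall_pos_or_forall_neg {f : ℝ → ℝ} (hf : Continuous f) (h0 : ∀ t, f t ≠ 0) :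
    (∀ t, 0 < f t) ∨ ∀ t, f t < 0 := by
  by_contra! h
  obtain ⟨⟨a, ha⟩, b, hb⟩ := h
  obtain ⟨t, ht⟩ := mem_range_of_exists_le_of_exists_ge hf ⟨a, ha⟩ ⟨b, hb⟩
  exact h0 t ht

theorem pstar_eq_self {P : ℂ[X]} (h : RealOnIm P) : pstar P = P := by
  refine eq_of_infinite_eval_eq _ _ (Set.Infinite.mono (s := Set.range fun t : ℝ =>
    (t * Complex.I : ℂ)) ?_ (Set.infinite_range_of_injective fun s t hst => by simpa using hst))
  rintro _ ⟨t, rfl⟩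
  obtain ⟨r, hr⟩ := h t
  rw [mul_comm] at hr
  simp [eval_pstar, hr]

theorem eval_eq_prod_roots (P : ℂ[X]) (y : ℂ) :
    P.eval y = P.leadingCoeff * (P.roots.map fun α => y - α).prod := by
  conv_lhs => rw [(IsAlgClosed.splits P).eq_prod_roots]
  simp [eval_multiset_prod, Multiset.map_map]

theorem roots_map_neg_conj {P : ℂ[X]} (hP : pstar P = P) :
    P.roots.map (fun α => -starRingEnd ℂ α) = P.roots := by
  by_cases hP0 : P = 0
  · simp [hP0]
  have h : P = C (starRingEnd ℂ P.leadingCoeff * (-1) ^ P.roots.card) *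
      ((P.roots.map fun α => -starRingEnd ℂ α).map fun β => X - C β).prod := by
    refine Polynomial.funext fun y => ?_
    conv_lhs => rw [← hP, eval_pstar, eval_eq_prod_roots]
    have : (P.roots.map fun α => y - -starRingEnd ℂ α).prod * (-1) ^ P.roots.card =
        (P.roots.map fun α => -y - starRingEnd ℂ α).prod := by
      rw [mul_comm, ← Multiset.card_map (fun α => y - -starRingEnd ℂ α), ← Multiset.prod_map_neg,
        Multiset.map_map]
      congr 2
      ext α
      simp
      ring
    simp only [map_mul, map_multiset_prod, Multiset.map_map, eval_mul, eval_C,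
      eval_multiset_prod, Function.comp_def, eval_sub, eval_X, map_sub, map_neg,
      Complex.conj_conj, ← this, eval_neg]
    ring
  have h0 : starRingEnd ℂ P.leadingCoeff * (-1) ^ P.roots.card ≠ 0 := by simpa using hP0
  conv_rhs => rw [h, roots_C_mul _ h0, roots_multiset_prod_X_sub_C]

theorem exists_signs {q k : ℝ → ℝ} (hq : Continuous q) (hk : Continuous k) (hq0 : ∀ t, q t ≠ 0)
    (hk0 : ∀ t, k t ≠ 0) : ∃ (a : ℝ) (j : ℕ), 1 ≤ j ∧ j ≤ 2 ∧
      (∀ t, 0 < a * (-1) ^ j / q t) ∧ ∀ t, 0 < -(a * k t) := by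
  rcases forall_pos_or_forall_neg hq hq0 with h | h <;>
    rcases forall_pos_or_forall_neg hk hk0 with h' | h'
  · exact ⟨-1, 1, by norm_num, by norm_num, by simpa using h, by simpa using h'⟩
  · exact ⟨1, 2, by norm_num, by norm_num, by simpa using h, by simpa using h'⟩
  · exact ⟨-1, 2, by norm_num, by norm_num, fun t => div_pos_of_neg_of_neg (by norm_num) (h t),
      by simpa using h'⟩
  · exact ⟨1, 1, by norm_num, by norm_num, fun t => div_pos_of_neg_of_neg (by norm_num) (h t),
      by simpa using h'⟩

/-- `P / Q(e^{πiy})`, where `Q` carries the roots of `P` in the open strip. -/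
theorem exists_cofactor {P : ℂ[X]} (hP0 : P ≠ 0) : ∃ K : ℂ → ℂ,
    (∀ y : ℂ, |y.re| ≤ 1 → DifferentiableAt ℂ K y) ∧ (∀ y : ℂ, |y.re| < 1 → K y ≠ 0) ∧
    ∀ y : ℂ, |y.re| ≤ 1 →
      P.eval y = K y * expProd (P.roots.filter fun α => |α.re| < 1) (expPi y) := by
  obtain ⟨D, hD⟩ := exists_prod_sub_eq_mul (P.roots.filter fun α => |α.re| < 1)
    fun α hα => (Multiset.mem_filter.1 hα).2
  set S' := P.roots.filter fun α => ¬|α.re| < 1 with hS'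
  have hd : Differentiable ℂ fun y : ℂ => (S'.map fun α => y - α).prod := by
    have : (fun y : ℂ => (S'.map fun α => y - α).prod)
        = fun y => ((S'.map fun α => X - C α).prod).eval y := by
      ext y; simp [eval_multiset_prod, Multiset.map_map]
    rw [this]
    exact Polynomial.differentiable _
  refine ⟨fun y => P.leadingCoeff * D y * (S'.map fun α => y - α).prod, fun y hy =>
    ((hD y hy).1.const_mul _).mul (hd y), fun y hy => ?_, fun y hy => ?_⟩
  · refine mul_ne_zero (mul_ne_zero (leadingCoeff_ne_zero.2 hP0) (hD y hy.le).2.1) fun h => ?_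
    obtain ⟨α, hα, h1⟩ := Multiset.mem_map.1 (Multiset.prod_eq_zero_iff.1 h)
    rw [← sub_eq_zero.1 h1] at hα
    exact (Multiset.mem_filter.1 hα).2 hy
  · have := (hD y hy).2.2
    rw [eval_eq_prod_roots]
    conv_lhs => rw [← Multiset.filter_add_not (fun α : ℂ => |α.re| < 1) P.roots, Multiset.map_add,
      Multiset.prod_add, this]
    rw [expProd]
    ring

theorem cofactor_real {P : ℂ[X]} (hP : pstar P = P) (hP0 : P ≠ 0) {K Q : ℂ → ℂ}
    (hK : Continuous fun t : ℝ => K (t * Complex.I)) (hQ : ∀ t : ℝ, starRingEnd ℂ (Q t) = Q t)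
    (hPK : ∀ t : ℝ, P.eval (t * Complex.I) = K (t * Complex.I) * Q (Real.exp (-(Real.pi * t)) : ℝ))
    (t : ℝ) : K (t * Complex.I) = (K (t * Complex.I)).re := by
  have hfin : {t : ℝ | P.eval (t * Complex.I) = 0}.Finite := by
    refine (P.roots.toFinset.finite_toSet.preimage
      (f := fun t : ℝ => (t * Complex.I : ℂ)) fun s _ t _ hst => by simpa using hst).subset ?_
    intro t ht
    simpa [hP0] using ht
  have hdense : Dense {t : ℝ | P.eval (t * Complex.I) = 0}ᶜ := hfin.countable.dense_compl ℝ
  have := Continuous.ext_on hdense (Complex.continuous_conj.comp hK) hK fun t ht => by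
    have hreal : starRingEnd ℂ (P.eval (t * Complex.I)) = P.eval (t * Complex.I) := by
      conv_rhs => rw [← hP, eval_pstar]
      simp
    have h1 : P.eval (t * Complex.I) ≠ 0 := ht
    rw [hPK] at hreal h1
    rw [map_mul, hQ] at hreal
    exact mul_right_cancel₀ (right_ne_zero_of_mul h1) hreal
  exact (Complex.conj_eq_iff_re.1 (congrFun this t)).symm

theorem unitarizable_of_three_le_card {P : ℂ[X]} (hP : pstar P = P) (hP0 : P ≠ 0)
    (hroots : 3 ≤ (P.roots.filter fun α => |α.re| < 1).card) :
    Unitarizable P := by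
  obtain ⟨K, hKd, hK0, hPK⟩ := exists_cofactor hP0
  set S := P.roots.filter fun α => |α.re| < 1 with hSdef
  have hS (α : ℂ) (hα : α ∈ S) : |α.re| < 1 := (Multiset.mem_filter.1 hα).2
  have hSconj : S.map (fun α => -starRingEnd ℂ α) = S := by
    conv_rhs => rw [hSdef, ← roots_map_neg_conj hP, Multiset.filter_map]
    simp [hSdef]
  have hQreal (x : ℝ) : starRingEnd ℂ (expProd S x) = expProd S x := by
    rw [conj_expProd hSconj, Complex.conj_ofReal]
  have hKc : Continuous fun t : ℝ => K (t * Complex.I) := continuous_iff_continuousAt.2 fun t =>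
    ContinuousAt.comp (f := fun t : ℝ => (t * Complex.I : ℂ))
      (hKd _ (by simp)).continuousAt (by fun_prop)
  have hKreal := cofactor_real hP hP0 hKc hQreal fun t => by
    rw [hPK _ (by simp), expPi_mul_I]
  set k : ℝ → ℝ := fun t => (K (t * Complex.I)).re
  have hQc := continuous_expProd S
  set q : ℝ → ℝ := fun t => (expProd S (-Real.exp (-(Real.pi * t)) : ℝ)).re with hqdef
  have hqr (t : ℝ) : expProd S (-Real.exp (-(Real.pi * t)) : ℝ) = q t :=
    (Complex.conj_eq_iff_re.1 (hQreal _)).symm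
  have hq0 (t : ℝ) : q t ≠ 0 := by
    have := expProd_neg_exp_ne_zero hS t
    rw [hqr] at this
    exact_mod_cast this
  have hqc : Continuous q := by
    refine Complex.continuous_re.comp (hQc.comp ?_)
    fun_prop
  obtain ⟨a, j, hj1, hj2, hw0, hκ0⟩ := exists_signs hqc (k := k)
    (Complex.continuous_re.comp hKc) hq0 fun t h => hK0 (t * Complex.I) (by simp) (by
      rw [hKreal t]
      exact_mod_cast h)
  obtain ⟨C, T, hC, hCT⟩ := exists_weight_bound S hj1 (by omega)
  have hdecay (x : ℝ) : Real.exp (-(Real.pi * |x|)) ≤ Real.exp (-(3 * |x|)) := by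
    gcongr
    exact Real.pi_gt_three.le
  set N : ℂ → ℂ := fun y => a * expPi y ^ j * K y with hNdef
  set w : ℝ → ℝ := fun t => a * (-Real.exp (-(Real.pi * t))) ^ j / q t with hwdef
  have hNd (y : ℂ) (hy : |y.re| ≤ 1) : DifferentiableAt ℂ N y :=
    (((differentiable_expPi y).pow j).const_mul _).mul (hKd y hy)
  have hwc : Continuous w := by
    refine Continuous.div ?_ hqc hq0
    fun_prop
  obtain ⟨C₁, hC₁⟩ : ∃ C', ∀ y ∈ {y : ℂ | |y.re| ≤ 1},
      ‖N y‖ ≤ C' * Real.exp (-(2 * |y.im|)) := by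
    obtain ⟨D, hD⟩ := exists_eval_bound P
    refine exists_norm_le_exp (fun y hy => (hNd y hy).continuousAt.continuousWithinAt)
      Complex.continuous_im (isCompact_strip T) (C := |a| * (D * C)) fun y hy hT => ?_
    obtain ⟨h1, h2⟩ := hCT y hT
    have h3 : N y = a * (P.eval y * (expPi y ^ j / expProd S (expPi y))) := by
      rw [hPK y hy]
      rw [hNdef]
      field_simp
    rw [h3, norm_mul, norm_mul, Complex.norm_real, Real.norm_eq_abs, mul_assoc]
    refine mul_le_mul_of_nonneg_left ?_ (abs_nonneg a)
    refine (mul_le_mul (hD y hy) (h2.trans (mul_le_mul_of_nonneg_left (hdecay _) hC))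
      (norm_nonneg _) ((norm_nonneg _).trans (hD y hy))).trans_eq ?_
    rw [mul_mul_mul_comm, ← Real.exp_add]
    ring_nf
  obtain ⟨C₂, hC₂⟩ : ∃ C', ∀ t ∈ (Set.univ : Set ℝ),
      ‖(w t : ℂ)‖ ≤ C' * Real.exp (-(2 * |t|)) := by
    refine exists_norm_le_exp (τ := fun t => t) (by fun_prop) continuous_id (T := T) ?_
      (C := |a| * C) fun t _ hT => ?_
    · rw [Set.univ_inter]
      have : {y : ℝ | |y| ≤ T} = Set.Icc (-T) T := by ext; simp [abs_le]
      rw [this]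
      exact isCompact_Icc
    · have h2 := (hCT ((1 : ℝ) + t * Complex.I) (by simpa using hT)).2
      rw [expPi_add_mul_I abs_one, hqr] at h2
      have h3 : (w t : ℂ) = a * (((-Real.exp (-(Real.pi * t)) : ℝ) : ℂ) ^ j / q t) := by
        rw [hwdef]
        push_cast
        ring
      rw [h3, norm_mul, Complex.norm_real, Real.norm_eq_abs, mul_assoc]
      refine mul_le_mul_of_nonneg_left (h2.trans (mul_le_mul_of_nonneg_left ?_ hC)) (abs_nonneg a)
      simp only [Complex.add_im, Complex.ofReal_im, Complex.mul_im, Complex.ofReal_re,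
        Complex.I_im, Complex.I_re, mul_one, mul_zero, add_zero, zero_add]
      refine (hdecay t).trans (Real.exp_le_exp.2 ?_)
      linarith [abs_nonneg t]
  refine unitarizable_of_weight hP hP0 (N := N) (w := w)
    (κ := fun t => Real.exp (-(Real.pi * t)) ^ j * -(a * k t)) (C := max C₁ C₂) hNd
    (fun y hy => (hC₁ y hy).trans (by gcongr; exact le_max_left _ _)) hwc (fun t => ?_)
    (fun t => ?_) (fun s hs t => ?_) (fun t => ?_) fun t => mul_pos (by positivity) (hκ0 t)
  · have : w t = a * (-1) ^ j / q t * Real.exp (-(Real.pi * t)) ^ j := by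
      rw [hwdef]
      dsimp only
      rw [neg_pow]
      ring
    rw [this]
    exact mul_pos (hw0 t) (by positivity)
  · have := hC₂ t trivial
    rw [Complex.norm_real] at this
    exact this.trans (by gcongr; exact le_max_right _ _)
  · have hq : (q t : ℂ) ≠ 0 := by exact_mod_cast hq0 t
    rw [hPK _ (by simp [hs]), hNdef, hwdef]
    dsimp only
    rw [expPi_add_mul_I hs, hqr]
    push_cast
    field_simp
  · rw [hNdef]
    dsimp only
    rw [expPi_mul_I, hKreal t]
    push_cast
    ring

/-- if `P` has degree `≥ 1`, is real on the imaginary axis, and has at least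
three roots (with multiplicity) `α` with `|Re α| < 1`, then `𝒜(P)` is unitarizable. -/
theorem stmt0 (P : ℂ[X]) (hdeg : 1 ≤ P.natDegree) (hreal : RealOnIm P)
    (hroots : 3 ≤ (P.roots.filter (fun z => |z.re| < 1)).card) :
    Unitarizable P := by
  exact unitarizable_of_three_le_card (pstar_eq_self hreal)
    (fun h => by simp [h] at hdeg) hroots

end
end

section
/- Let n = 2m be even and let P ∈ ℂ[x] be a polynomial of degree n that is real on the imaginary axis and has leading coefficient (−1)^m. If every root α of P satisfies |Re α| > 1, then the regular bimodule 𝒜(P) is not unitarizable: no invariant Hermitian form on 𝒜(P) is positive definite. -/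
open Polynomial
open scoped Classical

noncomputable section

theorem aeval_diagonal_apply {ι : Type*} (d : ι → ℂ) (M : Module.End ℂ (ι → ℂ))
    (hM : ∀ g k, M g k = d k * g k) (Q : ℂ[X]) (g : ι → ℂ) (k : ι) :
    aeval M Q g k = Q.eval (d k) * g k := by
  induction Q using Polynomial.induction_on' generalizing g with
  | add p q hp hq => simp [hp, hq, add_mul]
  | monomial n a =>
    simp only [aeval_monomial, eval_monomial, Module.End.mul_apply, Module.algebraMap_end_apply,
      Pi.smul_apply, smul_eq_mul, mul_assoc]
    congr 1
    induction n generalizing g with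
    | zero => simp
    | succ n ih => rw [pow_succ, Module.End.mul_apply, ih, hM]; ring

/-- The weight operator `h` on functions `ℤ → ℂ`. -/
def weightH : Module.End ℂ (ℤ → ℂ) where
  toFun g k := 2 * k * g k
  map_add' _ _ := by ext; simp [mul_add]
  map_smul' _ _ := by ext; simp; ring

/-- The raising operator `e` on functions `ℤ → ℂ`. -/
def weightE : Module.End ℂ (ℤ → ℂ) where
  toFun g k := g (k - 1)
  map_add' _ _ := rfl
  map_smul' _ _ := rfl

/-- The lowering operator `f` on functions `ℤ → ℂ`. -/
def weightF (P : ℂ[X]) : Module.End ℂ (ℤ → ℂ) where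
  toFun g k := P.eval (2 * k + 1 : ℂ) * g (k + 1)
  map_add' _ _ := by ext; simp [mul_add]
  map_smul' _ _ := by ext; simp; ring

theorem AP_one_ne_zero (P : ℂ[X]) : (1 : AP P) ≠ 0 := by
  let φ : FA →ₐ[ℂ] Module.End ℂ (ℤ → ℂ) :=
    FreeAlgebra.lift ℂ ![weightE, weightF P, weightH]
  have hE : φ Egen = weightE := by simp [φ, Egen]
  have hF : φ Fgen = weightF P := by simp [φ, Fgen]
  have hH : φ Hgen = weightH := by simp [φ, Hgen]
  have hφ : ∀ ⦃x y⦄, ARel P x y → φ x = φ y := by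
    intro x y h
    ext g k
    induction h with
    | he =>
      simp only [map_sub, map_mul, map_ofNat, hE, hH]
      simp [weightE, weightH, Module.End.mul_apply, Module.End.ofNat_apply]
      ring
    | hf =>
      simp only [map_sub, map_neg, map_mul, map_ofNat, hF, hH]
      simp [weightF, weightH, Module.End.mul_apply, Module.End.ofNat_apply]
      ring
    | ef =>
      rw [← aeval_algHom_apply, aeval_diagonal_apply (fun k : ℤ => (2 * k - 1 : ℂ))]
      · simp only [map_mul, hE, hF]
        simp only [weightE, weightF, Module.End.mul_apply, LinearMap.coe_mk, AddHom.coe_mk,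
          sub_add_cancel]
        congr 2
        push_cast
        ring
      · intro g k
        simp [hH, weightH]
        ring
    | fe =>
      rw [← aeval_algHom_apply, aeval_diagonal_apply (fun k : ℤ => (2 * k + 1 : ℂ))]
      · simp only [map_mul, hE, hF]
        simp [weightE, weightF, Module.End.mul_apply]
      · intro g k
        simp [hH, weightH]
        ring
  intro h
  have := congrArg (RingQuot.liftAlgHom ℂ ⟨φ, hφ⟩) h
  simp at this

/-- The conjugate-linear involution `R ↦ R̄(−x)`: complex conjugation of the values
on the imaginary axis. -/
def axisConj : ℂ[X] →+* ℂ[X] :=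
  (compRingHom (-X)).comp (mapRingHom (starRingEnd ℂ))

@[simp] theorem axisConj_C (a : ℂ) : axisConj (C a) = C (starRingEnd ℂ a) := by
  simp [axisConj]

@[simp] theorem axisConj_X : axisConj X = -X := by
  simp [axisConj]

namespace InvForm

variable {P : ℂ[X]} (Φ : InvForm P)

theorem add_right (u v w : AP P) : Φ.B u (v + w) = Φ.B u v + Φ.B u w := by
  rw [Φ.conj_symm, Φ.add_left, map_add, ← Φ.conj_symm, ← Φ.conj_symm]

theorem smul_right (c : ℂ) (u v : AP P) : Φ.B u (c • v) = starRingEnd ℂ c * Φ.B u v := by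
  rw [Φ.conj_symm, Φ.smul_left, map_mul, ← Φ.conj_symm]

/-- The functional `R ↦ (R(h), 1)` on polynomials. -/
def trace : ℂ[X] →ₗ[ℂ] ℂ where
  toFun R := Φ.B (aeval (hA P) R) 1
  map_add' R S := by rw [map_add, Φ.add_left]
  map_smul' c R := by rw [map_smul, Φ.smul_left]; rfl

theorem apply_aeval_mul (u v : AP P) (Q : ℂ[X]) :
    Φ.B u (aeval (hA P) Q * v) = Φ.B (u * aeval (hA P) (axisConj Q)) v := by
  induction Q using Polynomial.induction_on generalizing u v with
  | C a =>
    simp only [aeval_C, axisConj_C, ← Algebra.commutes, ← Algebra.smul_def, Φ.smul_left,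
      Φ.smul_right]
  | add p q hp hq => simp only [map_add, add_mul, mul_add, Φ.add_left, Φ.add_right, hp, hq]
  | monomial n a ih =>
    have hX : axisConj (C a * X ^ n * X) = (-1 : ℂ) • (axisConj (C a * X ^ n) * X) := by
      rw [map_mul axisConj (C a * X ^ n) X, axisConj_X, neg_one_smul, mul_neg]
    rw [pow_succ, ← mul_assoc, map_mul, aeval_X, mul_assoc, ih, hX, map_smul, map_mul _ _ X,
      aeval_X, mul_smul_comm, Φ.smul_left, ← mul_assoc, Φ.h_right, neg_one_mul, neg_neg]

theorem apply_aeval_aeval (A Q : ℂ[X]) :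
    Φ.B (aeval (hA P) A) (aeval (hA P) Q) = Φ.trace (A * axisConj Q) := by
  have := Φ.apply_aeval_mul (aeval (hA P) A) 1 Q
  rw [mul_one, ← map_mul] at this
  exact this

theorem hA_mul_eA : hA P * eA P = eA P * (hA P + 2) := by
  have := RingQuot.mkAlgHom_rel ℂ (ARel.he (P := P))
  simp only [map_sub, map_mul, map_ofNat] at this
  change hA P * eA P - eA P * hA P = 2 * eA P at this
  rw [mul_add, mul_two, ← two_mul, ← this]
  abel

theorem aeval_mul_eA (Q : ℂ[X]) :
    aeval (hA P) Q * eA P = eA P * aeval (hA P + 2) Q := by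
  induction Q using Polynomial.induction_on with
  | C a => simp only [aeval_C, Algebra.commutes]
  | add p q hp hq => simp only [map_add, add_mul, mul_add, hp, hq]
  | monomial n a ih =>
    rw [pow_succ, ← mul_assoc, map_mul, aeval_X, mul_assoc, hA_mul_eA, ← mul_assoc, ih,
      map_mul _ _ X, aeval_X, mul_assoc]

theorem eA_mul_fA : eA P * fA P = aeval (hA P - 1) P := by
  have := RingQuot.mkAlgHom_rel ℂ (ARel.ef (P := P))
  rwa [map_mul, ← aeval_algHom_apply, map_sub, map_one] at this

theorem fA_mul_eA : fA P * eA P = aeval (hA P + 1) P := by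
  have := RingQuot.mkAlgHom_rel ℂ (ARel.fe (P := P))
  rwa [map_mul, ← aeval_algHom_apply, map_add, map_one] at this

theorem aeval_comp_add_C (a : AP P) (c : ℂ) (Q : ℂ[X]) :
    aeval a (Q.comp (X + C c)) = aeval (a + algebraMap ℂ (AP P) c) Q := by
  rw [aeval_comp]; simp

theorem trace_shift (S : ℂ[X]) :
    Φ.trace ((P * S).comp (X + C 1)) = Φ.trace ((P * S).comp (X + C (-1))) := by
  have h : Φ.B (eA P * (fA P * aeval (hA P) (S.comp (X + C (-1))))) 1 =
      Φ.B (fA P * aeval (hA P) (S.comp (X + C (-1))) * eA P) 1 := by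
    rw [Φ.e_left, Φ.e_right, one_mul, mul_one]
  rw [← mul_assoc, eA_mul_fA, mul_assoc, aeval_mul_eA, ← mul_assoc, fA_mul_eA,
    aeval_comp_add_C, aeval_comp_add_C] at h
  change Φ.B (aeval (hA P) _) 1 = Φ.B (aeval (hA P) _) 1
  rw [aeval_comp_add_C, aeval_comp_add_C, map_mul, map_mul]
  have h2 : hA P + 2 + algebraMap ℂ (AP P) (-1) = hA P + algebraMap ℂ (AP P) 1 := by
    rw [map_neg, map_one, ← one_add_one_eq_two]; abel
  have h3 : hA P - 1 = hA P + algebraMap ℂ (AP P) (-1) := by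
    rw [map_neg, map_one, sub_eq_add_neg]
  rw [h2, h3, map_one] at h
  rw [map_one, h]

theorem norm_trace_sq_le (hpos : ∀ u : AP P, u ≠ 0 → ∃ r : ℝ, 0 < r ∧ Φ.B u u = r)
    (A Q : ℂ[X]) :
    ‖Φ.trace (A * axisConj Q)‖ ^ 2 ≤
      ‖Φ.trace (A * axisConj A)‖ * ‖Φ.trace (Q * axisConj Q)‖ := by
  have hnn : ∀ u : AP P, ∃ r : ℝ, 0 ≤ r ∧ Φ.B u u = r := by
    intro u
    by_cases hu : u = 0
    · refine ⟨0, le_rfl, ?_⟩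
      have := Φ.smul_left 0 u u
      rw [zero_smul, zero_mul, ← hu] at this
      simpa using this
    · obtain ⟨r, hr, h⟩ := hpos u hu
      exact ⟨r, hr.le, h⟩
  let c : PreInnerProductSpace.Core ℂ (AP P) :=
    { inner u v := Φ.B v u
      conj_inner_symm u v := (Φ.conj_symm v u).symm
      re_inner_nonneg u := by
        obtain ⟨r, hr, h⟩ := hnn u
        simpa [h] using hr
      add_left u v w := Φ.add_right w u v
      smul_left u v a := Φ.smul_right a v u }
  have h := InnerProductSpace.Core.inner_mul_inner_self_le (c := c)
    (aeval (hA P) Q) (aeval (hA P) A)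
  change ‖Φ.B (aeval (hA P) A) (aeval (hA P) Q)‖ * ‖Φ.B (aeval (hA P) Q) (aeval (hA P) A)‖ ≤
    (Φ.B (aeval (hA P) Q) (aeval (hA P) Q)).re * (Φ.B (aeval (hA P) A) (aeval (hA P) A)).re at h
  rw [Φ.conj_symm (aeval (hA P) Q) (aeval (hA P) A), RCLike.norm_conj, ← sq] at h
  rw [← Φ.apply_aeval_aeval, ← Φ.apply_aeval_aeval, ← Φ.apply_aeval_aeval]
  refine h.trans ?_
  rw [mul_comm]
  obtain ⟨r, hr, h1⟩ := hnn (aeval (hA P) A)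
  obtain ⟨t, ht, h2⟩ := hnn (aeval (hA P) Q)
  rw [h1, h2]
  simp [abs_of_nonneg hr, abs_of_nonneg ht]

end InvForm

section Flow

variable {Ω : Set ℂ} {L : ℂ → ℂ[X] →ₗ[ℂ] ℂ}

theorem iteratedDeriv_flow (hΩ : IsOpen Ω)
    (hL : ∀ z ∈ Ω, ∀ R, HasDerivAt (fun w => L w R) (L z (X * R)) z) (R : ℂ[X]) (n : ℕ)
    {z : ℂ} (hz : z ∈ Ω) : iteratedDeriv n (fun w => L w R) z = L z (X ^ n * R) := by
  induction n generalizing z with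
  | zero => simp
  | succ n ih =>
    rw [iteratedDeriv_succ]
    have : iteratedDeriv n (fun w => L w R) =ᶠ[nhds z] fun w => L w (X ^ n * R) := by
      filter_upwards [hΩ.mem_nhds hz] with w hw using ih hw
    rw [this.deriv_eq, (hL z hz _).deriv, ← mul_assoc, pow_succ']

theorem hasSum_flow (hΩ : IsOpen Ω)
    (hL : ∀ z ∈ Ω, ∀ R, HasDerivAt (fun w => L w R) (L z (X * R)) z) (R : ℂ[X])
    {c a : ℂ} {r : ℝ} (hc : Metric.ball c r ⊆ Ω) (ha : ‖a‖ < r) :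
    HasSum (fun n : ℕ => a ^ n / n.factorial * L c (X ^ n * R)) (L (c + a) R) := by
  have hd : DifferentiableOn ℂ (fun w => L w R) (Metric.ball c r) := fun z hz =>
    (hL z (hc hz) R).differentiableAt.differentiableWithinAt
  have hr : 0 < r := (norm_nonneg a).trans_lt ha
  have h := Complex.hasSum_taylorSeries_on_ball hd (z := c + a) (by simpa using ha)
  refine h.congr_fun ?_
  intro n
  rw [iteratedDeriv_flow hΩ hL R n (hc (Metric.mem_ball_self hr)), add_sub_cancel_left,
    smul_eq_mul, smul_eq_mul]
  ring

end Flow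

theorem sum_antidiagonal_pow_div_factorial {𝕜 : Type*} [Field 𝕜] [CharZero 𝕜] (x y : 𝕜) (n : ℕ) :
    ∑ p ∈ Finset.HasAntidiagonal.antidiagonal n,
        x ^ p.1 / p.1.factorial * (y ^ p.2 / p.2.factorial) =
      (x + y) ^ n / n.factorial := by
  rw [(Commute.all x y).add_pow', Finset.sum_div]
  refine Finset.sum_congr rfl fun p hp => ?_
  rw [Finset.HasAntidiagonal.mem_antidiagonal] at hp
  have h1 : (p.1.factorial : 𝕜) ≠ 0 := by exact_mod_cast p.1.factorial_ne_zero
  have h2 : (p.2.factorial : 𝕜) ≠ 0 := by exact_mod_cast p.2.factorial_ne_zero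
  have h3 : (n.factorial : 𝕜) ≠ 0 := by exact_mod_cast n.factorial_ne_zero
  rw [← hp] at h3 ⊢
  rw [nsmul_eq_mul, Nat.cast_add_choose]
  field_simp

/-- The truncated exponential series of `a x`. -/
def expTrunc (a : ℂ) (n : ℕ) : ℂ[X] :=
  ∑ k ∈ Finset.range n, C (a ^ k / k.factorial) * X ^ k

theorem axisConj_expTrunc (a : ℝ) (n : ℕ) : axisConj (expTrunc a n) = expTrunc (-a) n := by
  simp only [expTrunc, map_sum]
  refine Finset.sum_congr rfl fun k _ => ?_
  simp only [map_mul, map_pow, axisConj_C, axisConj_X, map_div₀, Complex.conj_ofReal,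
    map_natCast, neg_pow (X : ℂ[X]), neg_pow (a : ℂ), mul_div_assoc, C_neg, C_1]
  ring

theorem apply_expTrunc_mul (S : ℂ[X] →ₗ[ℂ] ℂ) (a : ℂ) (n : ℕ) (R : ℂ[X]) :
    S (expTrunc a n * R) =
      ∑ k ∈ Finset.range n, a ^ k / k.factorial * S (X ^ k * R) := by
  simp only [expTrunc, Finset.sum_mul, map_sum, ← smul_eq_C_mul, smul_mul_assoc, map_smul,
    smul_eq_mul]

theorem tendsto_apply_expTrunc_mul_expTrunc_neg (S : ℂ[X] →ₗ[ℂ] ℂ) (a : ℂ) (R : ℂ[X])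
    (hs : Summable fun n : ℕ => (2 * ‖a‖) ^ n / n.factorial * ‖S (X ^ n * R)‖) :
    Filter.Tendsto (fun n => S (expTrunc a n * (expTrunc (-a) n * R))) Filter.atTop
      (nhds (S R)) := by
  let f : ℕ × ℕ → ℂ := fun p =>
    a ^ p.1 / p.1.factorial * ((-a) ^ p.2 / p.2.factorial) * S (X ^ (p.1 + p.2) * R)
  have hf : HasSum f (S R) := by
    rw [← Finset.HasAntidiagonal.sigmaAntidiagonalEquivProd.hasSum_iff]
    have hg : HasSum (fun n : ℕ => (a + -a) ^ n / n.factorial * S (X ^ n * R)) (S R) := by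
      have := hasSum_single (f := fun n : ℕ => (a + -a) ^ n / n.factorial * S (X ^ n * R)) 0
        (fun n hn => by simp [hn])
      simpa using this
    refine HasSum.sigma_of_hasSum hg (fun n => ?_) ?_
    · rw [← sum_antidiagonal_pow_div_factorial, Finset.sum_mul, ← Finset.sum_coe_sort]
      convert hasSum_fintype _ using 2 with p
      have hp := Finset.HasAntidiagonal.mem_antidiagonal.1 p.2
      simp [f, hp]
    · refine Summable.of_norm ((summable_sigma_of_nonneg fun _ => norm_nonneg _).2
        ⟨fun n => Summable.of_finite, hs.congr fun n => ?_⟩)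
      rw [tsum_fintype, two_mul, ← sum_antidiagonal_pow_div_factorial, Finset.sum_mul,
        ← Finset.sum_coe_sort]
      refine Finset.sum_congr rfl fun p _ => ?_
      have hp := Finset.HasAntidiagonal.mem_antidiagonal.1 p.2
      simp [f, hp]
  have hr : Filter.Tendsto (fun n => Finset.range n ×ˢ Finset.range n) Filter.atTop
      (Filter.atTop : Filter (Finset (ℕ × ℕ))) :=
    Filter.tendsto_atTop_finset_of_monotone
      (fun m n h => Finset.product_subset_product (Finset.range_mono h) (Finset.range_mono h))
      fun p => ⟨p.1 + p.2 + 1, by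
        rw [Finset.mem_product, Finset.mem_range, Finset.mem_range]
        omega⟩
  refine (hf.comp hr).congr fun n => ?_
  rw [apply_expTrunc_mul]
  simp only [Function.comp, Finset.sum_product, f]
  refine Finset.sum_congr rfl fun j _ => ?_
  rw [mul_left_comm, apply_expTrunc_mul, Finset.mul_sum]
  refine Finset.sum_congr rfl fun k _ => ?_
  rw [← mul_assoc (X ^ k), ← pow_add, add_comm k j]
  ring

section Flow

variable {Ω : Set ℂ} {L : ℂ → ℂ[X] →ₗ[ℂ] ℂ}

/-- A local flow extending a positive functional acts by isometries along the real line. -/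
theorem norm_flow_sq_le (hΩ : IsOpen Ω)
    (hL : ∀ z ∈ Ω, ∀ R, HasDerivAt (fun w => L w R) (L z (X * R)) z)
    {r : ℝ} (hr : 0 < r) (hball : ∀ s : ℝ, Metric.ball (s : ℂ) r ⊆ Ω)
    (hpos : ∀ A Q, ‖L 0 (A * axisConj Q)‖ ^ 2 ≤
      ‖L 0 (A * axisConj A)‖ * ‖L 0 (Q * axisConj Q)‖) (s : ℝ) (A Q : ℂ[X]) :
    ‖L s (A * axisConj Q)‖ ^ 2 ≤ ‖L 0 (A * axisConj A)‖ * ‖L 0 (Q * axisConj Q)‖ := by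
  have step : ∀ s a : ℝ, |a| < r / 4 →
      (∀ A Q, ‖L s (A * axisConj Q)‖ ^ 2 ≤
        ‖L 0 (A * axisConj A)‖ * ‖L 0 (Q * axisConj Q)‖) →
      ∀ A Q, ‖L (s + a : ℝ) (A * axisConj Q)‖ ^ 2 ≤
        ‖L 0 (A * axisConj A)‖ * ‖L 0 (Q * axisConj Q)‖ := by
    intro s a ha h A Q
    have hna : ‖(a : ℂ)‖ = |a| := by simp
    have h1 : Filter.Tendsto (fun n => L s (expTrunc a n * (A * axisConj Q))) Filter.atTop
        (nhds (L (s + a : ℝ) (A * axisConj Q))) := by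
      have := (hasSum_flow hΩ hL (A * axisConj Q) (hball s)
        (a := a) (by rw [hna]; linarith)).tendsto_sum_nat
      push_cast
      exact this.congr fun n => (apply_expTrunc_mul _ _ _ _).symm
    have h2 : Filter.Tendsto
        (fun n => L 0 (expTrunc a n * (expTrunc (-a) n * (A * axisConj A)))) Filter.atTop
        (nhds (L 0 (A * axisConj A))) := by
      apply tendsto_apply_expTrunc_mul_expTrunc_neg
      have := (hasSum_flow hΩ hL (A * axisConj A) (c := 0) (by simpa using hball 0)
        (a := (2 * |a| : ℝ)) (by
          rw [Complex.norm_real, Real.norm_eq_abs, abs_of_nonneg (by positivity)]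
          linarith)).summable.norm
      refine this.congr fun n => ?_
      simp
    refine le_of_tendsto_of_tendsto' (h1.norm.pow 2) (h2.norm.mul_const _) fun n => ?_
    have := h (expTrunc a n * A) Q
    rwa [mul_assoc, map_mul axisConj, axisConj_expTrunc,
      show expTrunc a n * A * (expTrunc (-a) n * axisConj A) =
        expTrunc a n * (expTrunc (-a) n * (A * axisConj A)) by ring] at this
  obtain ⟨N, hN⟩ := exists_nat_gt (|s| / (r / 4))
  have hN0 : (0 : ℝ) < N := lt_of_le_of_lt (by positivity) hN
  have hall : ∀ k : ℕ, ∀ A Q, ‖L (k * (s / N) : ℝ) (A * axisConj Q)‖ ^ 2 ≤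
        ‖L 0 (A * axisConj A)‖ * ‖L 0 (Q * axisConj Q)‖ := by
    intro k
    induction k with
    | zero => simpa using hpos
    | succ k ih =>
      have := step (k * (s / N)) (s / N) (by
        rw [abs_div, Nat.abs_cast, div_lt_iff₀ hN0]
        rw [div_lt_iff₀ (by positivity)] at hN
        linarith) ih
      rwa [show (k : ℝ) * (s / N) + s / N = ((k + 1 : ℕ) : ℝ) * (s / N) by push_cast; ring] at this
  have := hall N A Q
  rwa [mul_div_cancel₀ _ hN0.ne'] at this

end Flow

/-- A functional on `ℂ[X]` killing the ideal `(P)` extends to an entire flow killing `(P)`. -/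
theorem exists_entire_flow {P : ℂ[X]} (hP : P ≠ 0) (D : ℂ[X] →ₗ[ℂ] ℂ)
    (hD : ∀ S, D (P * S) = 0) :
    ∃ Ψ : ℂ → ℂ[X] →ₗ[ℂ] ℂ, Ψ 0 = D ∧
      (∀ z R, HasDerivAt (fun w => Ψ w R) (Ψ z (X * R)) z) ∧ ∀ z S, Ψ z (P * S) = 0 := by
  let _ := Matrix.linftyOpNormedRing (n := Fin (AdjoinRoot.powerBasis hP).dim) (α := ℂ)
  let _ := Matrix.linftyOpNormedAlgebra (R := ℂ) (n := Fin (AdjoinRoot.powerBasis hP).dim) (α := ℂ)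
  let m := Algebra.leftMulMatrix (AdjoinRoot.powerBasis hP).basis
  have hm : Function.Injective m := Algebra.leftMulMatrix_injective _
  obtain ⟨g, hg⟩ := m.toLinearMap.exists_leftInverse_of_injective (LinearMap.ker_eq_bot.2 hm)
  let q : ℂ[X] →ₐ[ℂ] AdjoinRoot P := AdjoinRoot.mkₐ P
  have hq : Function.Surjective q := AdjoinRoot.mk_surjective
  have hker : LinearMap.ker q.toLinearMap ≤ LinearMap.ker D := by
    intro R hR
    obtain ⟨S, rfl⟩ := AdjoinRoot.mk_eq_zero.1 (show AdjoinRoot.mk P R = 0 from hR)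
    exact hD S
  obtain ⟨q', hq'⟩ := q.toLinearMap.exists_rightInverse_of_surjective (LinearMap.range_eq_top.2 hq)
  have hDq : ∀ R, D (q' (q R)) = D R := by
    intro R
    have : q' (q R) - R ∈ LinearMap.ker q.toLinearMap := by
      have := LinearMap.congr_fun hq' (q R)
      simpa [sub_eq_zero] using this
    simpa [sub_eq_zero] using hker this
  let ℓ := (D ∘ₗ q') ∘ₗ g
  have hℓ : ∀ R, ℓ (m (q R)) = D R := by
    intro R
    have := LinearMap.congr_fun hg (q R)
    simp only [LinearMap.comp_apply, AlgHom.toLinearMap_apply, LinearMap.id_apply] at this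
    simp only [ℓ, LinearMap.comp_apply, this, hDq]
  let ρ : ℂ[X] →ₐ[ℂ] _ := m.comp q
  let M := ρ X
  refine ⟨fun z => ℓ ∘ₗ LinearMap.mulLeft ℂ (NormedSpace.exp (z • M)) ∘ₗ ρ.toLinearMap, ?_, ?_, ?_⟩
  · refine LinearMap.ext fun R => ?_
    simp [NormedSpace.exp_zero, ρ, hℓ]
  · intro z R
    have h := (hasDerivAt_exp_smul_const (𝕂 := ℂ) M z).mul_const (ρ R)
    have h2 := (LinearMap.toContinuousLinearMap ℓ).hasFDerivAt.comp_hasDerivAt z h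
    simp only [LinearMap.comp_apply, LinearMap.mulLeft_apply, AlgHom.toLinearMap_apply, map_mul,
      ← mul_assoc]
    exact h2
  · intro z S
    have : q (P * S) = 0 := AdjoinRoot.mk_eq_zero.2 (dvd_mul_right _ _)
    simp [ρ, this]

theorem sinh_ne_zero_of_abs_im_lt_pi {z : ℂ} (hz : |z.im| < Real.pi) (h0 : z ≠ 0) :
    Complex.sinh z ≠ 0 := by
  intro h
  have h1 : Complex.exp (2 * z) = 1 := by
    rw [Complex.sinh, div_eq_zero_iff, sub_eq_zero] at h
    have h2 := h.resolve_right two_ne_zero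
    rw [two_mul, Complex.exp_add]
    nth_rewrite 1 [h2]
    rw [← Complex.exp_add, neg_add_cancel, Complex.exp_zero]
  obtain ⟨n, hn⟩ := Complex.exp_eq_one_iff.1 h1
  have h2 : z = n * (Real.pi * Complex.I) := by
    linear_combination hn / 2
  have h3 : z.im = n * Real.pi := by rw [h2]; simp
  rw [h3, abs_mul, abs_of_pos Real.pi_pos] at hz
  have h4 : |(n : ℝ)| < 1 := by
    by_contra! h
    nlinarith [Real.pi_pos]
  have h5 : n = 0 := Int.abs_lt_one_iff.1 (by exact_mod_cast h4)
  exact h0 (by simp [h2, h5])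

theorem eq_zero_of_comp_shift_sub (N : ℂ[X] →ₗ[ℂ] ℂ)
    (hN : ∀ R : ℂ[X], N (R.comp (X + C 1) - R.comp (X + C (-1))) = 0) : N = 0 := by
  have hpow : ∀ n : ℕ, N (X ^ n) = 0 := by
    intro n
    induction n using Nat.strong_induction_on with
    | _ n ih =>
      have key : ∀ c : ℂ, N ((X ^ (n + 1) : ℂ[X]).comp (X + C c)) =
          c * (n + 1) * N (X ^ n) + N (X ^ (n + 1)) := by
        intro c
        rw [X_pow_comp, add_pow, map_sum]
        have hterm : ∀ j, N (X ^ j * C c ^ (n + 1 - j) * ((n + 1).choose j : ℂ[X])) =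
            c ^ (n + 1 - j) * (n + 1).choose j * N (X ^ j) := by
          intro j
          rw [← C_pow, ← C_eq_natCast, mul_assoc, ← C_mul, mul_comm, ← smul_eq_C_mul, map_smul,
            smul_eq_mul]
        simp only [hterm]
        rw [Finset.sum_range_succ, Finset.sum_range_succ, Finset.sum_eq_zero]
        · simp
        · intro j hj
          rw [ih j (Finset.mem_range.1 hj), mul_zero]
      have h := hN (X ^ (n + 1))
      rw [map_sub, key, key] at h
      have h2 : (2 * (n + 1) : ℂ) * N (X ^ n) = 0 := by linear_combination h
      exact (mul_eq_zero.1 h2).resolve_left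
        (mul_ne_zero two_ne_zero (Nat.cast_add_one_ne_zero n))
  refine LinearMap.ext fun R => ?_
  induction R using Polynomial.induction_on' with
  | add p q hp hq => simpa [hp] using hq
  | monomial n a => rw [← mul_one a, ← smul_eq_mul, ← smul_monomial, map_smul,
      monomial_one_right_eq_X_pow, hpow]; simp

/-- The jets of a holomorphic function form a flow. -/
theorem exists_flow_of_differentiableOn {Ω : Set ℂ} (hΩ : IsOpen Ω) {φ : ℂ → ℂ}
    (hφ : DifferentiableOn ℂ φ Ω) :
    ∃ L : ℂ → ℂ[X] →ₗ[ℂ] ℂ, (∀ z, L z 1 = φ z) ∧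
      ∀ z ∈ Ω, ∀ R, HasDerivAt (fun w => L w R) (L z (X * R)) z := by
  let L : ℂ → ℂ[X] →ₗ[ℂ] ℂ := fun z => (basisMonomials ℂ).constr ℂ fun k => iteratedDeriv k φ z
  have hmon : ∀ z k a, L z (monomial k a) = a * iteratedDeriv k φ z := by
    intro z k a
    have := (basisMonomials ℂ).constr_basis ℂ (fun k => iteratedDeriv k φ z) k
    rw [← mul_one a, ← smul_eq_mul, ← smul_monomial, map_smul, smul_eq_mul, smul_eq_mul, mul_one]
    rw [coe_basisMonomials] at this
    rw [this]
  refine ⟨L, fun z => ?_, fun z hz R => ?_⟩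
  · rw [← monomial_zero_one, hmon]; simp
  · induction R using Polynomial.induction_on' with
    | add p q hp hq =>
      simp only [map_add, mul_add]
      exact hp.add hq
    | monomial n a =>
      simp only [X_mul_monomial, hmon]
      refine HasDerivAt.const_mul a ?_
      rw [iteratedDeriv_succ, hasDerivAt_deriv_iff, iteratedDeriv_eq_iterate]
      exact ((hφ.analyticOnNhd hΩ).iterated_deriv n z hz).differentiableAt

/-- Dividing an entire flow by `2 sinh` extends the functional to a flow on the strip. -/
theorem exists_strip_flow (T : ℂ[X] →ₗ[ℂ] ℂ) (Ψ : ℂ → ℂ[X] →ₗ[ℂ] ℂ)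
    (h0 : ∀ R, Ψ 0 R = T (R.comp (X + C 1) - R.comp (X + C (-1))))
    (hΨ : ∀ z R, HasDerivAt (fun w => Ψ w R) (Ψ z (X * R)) z) :
    ∃ L : ℂ → ℂ[X] →ₗ[ℂ] ℂ, L 0 = T ∧
      (∀ z : ℂ, |z.im| < Real.pi → ∀ R, HasDerivAt (fun w => L w R) (L z (X * R)) z) ∧
      ∀ z : ℂ, |z.im| < Real.pi → ∀ R, Complex.exp z * L z (R.comp (X + C 1)) -
        Complex.exp (-z) * L z (R.comp (X + C (-1))) = Ψ z R := by
  let Ω : Set ℂ := {z | |z.im| < Real.pi}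
  have hΩ : IsOpen Ω := isOpen_lt (by fun_prop) continuous_const
  have h0Ω : (0 : ℂ) ∈ Ω := by simp [Ω, Real.pi_pos]
  let ψ : ℂ → ℂ := fun z => Ψ z 1
  have hψ0 : ψ 0 = 0 := by simp [ψ, h0]
  have hψ : Differentiable ℂ ψ := fun z => (hΨ z 1).differentiableAt
  let φ : ℂ → ℂ := fun z => dslope ψ 0 z / (2 * dslope Complex.sinh 0 z)
  have hne : ∀ z ∈ Ω, dslope Complex.sinh 0 z ≠ 0 := by
    intro z hz
    by_cases h : z = 0
    · rw [h, dslope_same, Complex.deriv_sinh, Complex.cosh_zero]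
      exact one_ne_zero
    · have := sub_smul_dslope Complex.sinh 0 z
      intro h'
      rw [h', smul_zero, Complex.sinh_zero, sub_zero] at this
      exact sinh_ne_zero_of_abs_im_lt_pi hz h this.symm
  have hφ : DifferentiableOn ℂ φ Ω := by
    have hn := hΩ.mem_nhds h0Ω
    refine ((Complex.differentiableOn_dslope hn).2 hψ.differentiableOn).div
      (((Complex.differentiableOn_dslope hn).2
        Complex.differentiable_sinh.differentiableOn).const_mul 2) fun z hz => ?_
    exact mul_ne_zero two_ne_zero (hne z hz)
  obtain ⟨L, hL1, hL⟩ := exists_flow_of_differentiableOn hΩ hφ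
  have hrel : ∀ R, ∀ z ∈ Ω, Complex.exp z * L z (R.comp (X + C 1)) -
      Complex.exp (-z) * L z (R.comp (X + C (-1))) = Ψ z R := by
    intro R
    induction R using Polynomial.induction_on with
    | C a =>
      intro z hz
      simp only [C_comp]
      rw [← mul_one (C a), ← smul_eq_C_mul, map_smul, map_smul, hL1, smul_eq_mul, smul_eq_mul]
      have h1 := sub_smul_dslope Complex.sinh 0 z
      have h2 : (z - 0) • dslope ψ 0 z = ψ z - ψ 0 := sub_smul_dslope ψ 0 z
      rw [Complex.sinh_zero, sub_zero, sub_zero, smul_eq_mul] at h1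
      rw [hψ0, sub_zero, sub_zero, smul_eq_mul] at h2
      have h3 : Complex.exp z - Complex.exp (-z) = 2 * (z * dslope Complex.sinh 0 z) := by
        rw [h1, Complex.two_sinh]
      have h4 : 2 * dslope Complex.sinh 0 z * φ z = dslope ψ 0 z :=
        mul_div_cancel₀ _ (mul_ne_zero two_ne_zero (hne z hz))
      change _ = a * ψ z
      rw [← h2, ← h4]
      linear_combination a * φ z * h3
    | add p q hp hq =>
      intro z hz
      simp only [add_comp, map_add]
      linear_combination hp z hz + hq z hz
    | monomial n a ih =>
      intro z hz
      have hder : ∀ c : ℂ, ∀ Q : ℂ[X],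
          HasDerivAt (fun w => Complex.exp (c * w) * L w (Q.comp (X + C c)))
          (Complex.exp (c * z) * L z ((X * Q).comp (X + C c))) z := by
        intro c Q
        have he : HasDerivAt (fun w => Complex.exp (c * w)) (Complex.exp (c * z) * c) z := by
          simpa using ((hasDerivAt_id z).const_mul c).cexp
        refine (he.mul (hL z hz (Q.comp (X + C c)))).congr_deriv ?_
        rw [mul_comp, X_comp, add_mul, map_add, ← smul_eq_C_mul, map_smul, smul_eq_mul]
        ring
      have h1 := (hder 1 (C a * X ^ n)).sub (hder (-1) (C a * X ^ n))
      have h2 := (hΨ z (C a * X ^ n)).congr_of_eventuallyEq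
        (Filter.eventuallyEq_of_mem (hΩ.mem_nhds hz) ih)
      have h3 : X * (C a * X ^ n) = C a * X ^ (n + 1) := by ring
      simp only [one_mul, neg_one_mul, h3] at h1 h2
      exact h1.unique h2
  refine ⟨L, ?_, hL, fun z hz R => hrel R z hz⟩
  rw [← sub_eq_zero]
  refine eq_zero_of_comp_shift_sub _ fun R => ?_
  have := hrel R 0 h0Ω
  rw [h0, neg_zero, Complex.exp_zero, one_mul, one_mul, ← map_sub] at this
  rw [LinearMap.sub_apply, this, sub_self]

/-- A flow of growth `O(exp |s|)` on the real line has no modes `exp (α s)` with `1 < |Re α|`. -/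
theorem flow_eq_zero {Ψ : ℂ → ℂ[X] →ₗ[ℂ] ℂ}
    (hΨ : ∀ z R, HasDerivAt (fun w => Ψ w R) (Ψ z (X * R)) z)
    (hgrowth : ∀ R, ∃ K : ℝ, ∀ s : ℝ, ‖Ψ s R‖ ≤ K * Real.exp |s|)
    (t : Multiset ℂ) (ht : ∀ α ∈ t, 1 < |α.re|)
    (h : ∀ z R, Ψ z ((t.map fun α => X - C α).prod * R) = 0) (z : ℂ) (R : ℂ[X]) : Ψ z R = 0 := by
  induction t using Multiset.induction_on generalizing z R with
  | empty => simpa using h z R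
  | cons α t ih =>
    refine ih (fun β hβ => ht β (Multiset.mem_cons_of_mem hβ)) (fun z R => ?_) z R
    set Q := (t.map fun α => X - C α).prod * R with hQ
    have hX : ∀ z, Ψ z (X * Q) = α * Ψ z Q := by
      intro z
      have := h z R
      rw [Multiset.map_cons, Multiset.prod_cons, mul_assoc, ← hQ, sub_mul, map_sub,
        ← smul_eq_C_mul, map_smul, sub_eq_zero] at this
      exact this
    have hconst : ∀ z, Ψ z Q = Complex.exp (α * z) * Ψ 0 Q := by
      have hd : ∀ z, HasDerivAt (fun w => Complex.exp (-(α * w)) * Ψ w Q) 0 z := by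
        intro z
        have he : HasDerivAt (fun w => Complex.exp (-(α * w))) (Complex.exp (-(α * z)) * -α) z := by
          simpa using ((hasDerivAt_id z).const_mul α).neg.cexp
        refine (he.mul (hΨ z Q)).congr_deriv ?_
        rw [hX]
        ring
      intro z
      have := is_const_of_deriv_eq_zero (fun z => (hd z).differentiableAt)
        (fun z => (hd z).deriv) z 0
      simp only [mul_zero, neg_zero, Complex.exp_zero, one_mul] at this
      rw [← this, ← mul_assoc, ← Complex.exp_add, add_neg_cancel, Complex.exp_zero, one_mul]
    suffices Ψ 0 Q = 0 by rw [hconst, this, mul_zero]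
    by_contra hne
    obtain ⟨K, hK⟩ := hgrowth Q
    have hα := ht α (Multiset.mem_cons_self α t)
    have hbound : ∀ u : ℝ, 0 ≤ u → Real.exp ((|α.re| - 1) * u) * ‖Ψ 0 Q‖ ≤ K := by
      intro u hu
      have hs : ∃ s : ℝ, |s| = u ∧ α.re * s = |α.re| * u := by
        rcases abs_cases α.re with ⟨h1, -⟩ | ⟨h1, -⟩
        · exact ⟨u, abs_of_nonneg hu, by rw [h1]⟩
        · exact ⟨-u, by rw [abs_neg, abs_of_nonneg hu], by rw [h1]; ring⟩
      obtain ⟨s, hs1, hs2⟩ := hs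
      have := hK s
      rw [hconst, norm_mul, Complex.norm_exp, Complex.re_mul_ofReal, hs1, hs2] at this
      rw [sub_mul, one_mul, Real.exp_sub, div_mul_eq_mul_div, div_le_iff₀ (Real.exp_pos u)]
      exact this
    have hnorm : 0 < ‖Ψ 0 Q‖ := norm_pos_iff.2 hne
    have hK0 : 0 ≤ K := le_trans (by positivity) (hbound 0 le_rfl)
    have hpos : 0 < |α.re| - 1 := by linarith
    have := hbound (K / ‖Ψ 0 Q‖ / (|α.re| - 1)) (by positivity)
    rw [mul_div_cancel₀ _ hpos.ne', ← le_div_iff₀ hnorm] at this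
    linarith [Real.add_one_le_exp (K / ‖Ψ 0 Q‖)]

theorem exists_norm_flow_ofReal_le {L : ℂ → ℂ[X] →ₗ[ℂ] ℂ}
    (hL : ∀ z : ℂ, |z.im| < Real.pi → ∀ R, HasDerivAt (fun w => L w R) (L z (X * R)) z)
    (hpos : ∀ A Q, ‖L 0 (A * axisConj Q)‖ ^ 2 ≤
      ‖L 0 (A * axisConj A)‖ * ‖L 0 (Q * axisConj Q)‖) (R : ℂ[X]) :
    ∃ K : ℝ, ∀ s : ℝ, ‖L s R‖ ≤ K := by
  refine ⟨√(‖L 0 (R * axisConj R)‖ * ‖L 0 (1 * axisConj 1)‖), fun s => ?_⟩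
  have hball : ∀ s : ℝ, Metric.ball (s : ℂ) Real.pi ⊆ {z | |z.im| < Real.pi} := by
    intro s z hz
    rw [mem_ball_iff_norm] at hz
    have := (Complex.abs_im_le_norm (z - s)).trans_lt hz
    simpa using this
  have := norm_flow_sq_le (Ω := {z | |z.im| < Real.pi}) (isOpen_lt (by fun_prop) continuous_const) hL
    Real.pi_pos hball hpos s R 1
  rw [map_one, mul_one, mul_one] at this
  rw [map_one, mul_one]
  exact Real.le_sqrt_of_sq_le this

/-- if `P` has even degree `n = 2m`, leading coefficient `(−1)^m`, is real on
the imaginary axis, and all roots `α` of `P` satisfy `|Re α| > 1`, then `𝒜(P)` is not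
unitarizable. -/
theorem stmt2 (m : ℕ) (hm : 1 ≤ m) (P : ℂ[X]) (hdeg : P.natDegree = 2 * m)
    (hlead : P.leadingCoeff = (-1 : ℂ) ^ m) (hreal : RealOnIm P)
    (hroots : ∀ α ∈ P.roots, 1 < |α.re|) :
    ¬ Unitarizable P := by
  rintro ⟨Φ, hpos⟩
  have hP : P ≠ 0 := by
    rintro rfl
    rw [natDegree_zero] at hdeg
    omega
  let D : ℂ[X] →ₗ[ℂ] ℂ := Φ.trace ∘ₗ
    ((aeval (X + C 1)).toLinearMap - (aeval (X + C (-1))).toLinearMap)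
  have hD : ∀ R, D R = Φ.trace (R.comp (X + C 1) - R.comp (X + C (-1))) := fun _ => rfl
  obtain ⟨Ψ, hΨ0, hΨ, hΨP⟩ := exists_entire_flow hP D fun S => by
    rw [hD, map_sub, Φ.trace_shift, sub_self]
  obtain ⟨L, hL0, hL, hLΨ⟩ := exists_strip_flow Φ.trace Ψ (fun R => by rw [hΨ0, hD]) hΨ
  have hbound := exists_norm_flow_ofReal_le hL (by rw [hL0]; exact Φ.norm_trace_sq_le hpos)
  have hgrowth : ∀ R, ∃ K : ℝ, ∀ s : ℝ, ‖Ψ s R‖ ≤ K * Real.exp |s| := by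
    intro R
    obtain ⟨K₁, h₁⟩ := hbound (R.comp (X + C 1))
    obtain ⟨K₂, h₂⟩ := hbound (R.comp (X + C (-1)))
    refine ⟨K₁ + K₂, fun s => ?_⟩
    rw [← hLΨ s (by simp [Real.pi_pos])]
    refine (norm_sub_le _ _).trans ?_
    rw [norm_mul, norm_mul, Complex.norm_exp, Complex.norm_exp, Complex.neg_re, Complex.ofReal_re,
      add_mul, mul_comm K₁, mul_comm K₂]
    have e₁ := Real.exp_le_exp.2 (le_abs_self s)
    have e₂ := Real.exp_le_exp.2 (neg_le_abs s)
    gcongr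
    exacts [h₁ s, h₂ s]
  have hΨzero := flow_eq_zero hΨ hgrowth P.roots hroots fun z R => by
    have h := hΨP z (C P.leadingCoeff⁻¹ * R)
    have hc : C P.leadingCoeff * C P.leadingCoeff⁻¹ = 1 := by
      rw [← C_mul, mul_inv_cancel₀ (leadingCoeff_ne_zero.2 hP), C_1]
    generalize P.leadingCoeff⁻¹ = b at h hc
    rwa [(IsAlgClosed.splits P).eq_prod_roots, mul_mul_mul_comm, hc, one_mul] at h
  have hX := hΨzero 0 X
  rw [hΨ0, hD, X_comp, X_comp, show X + C 1 - (X + C (-1)) = (2 : ℂ) • (1 : ℂ[X]) by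
    rw [smul_eq_C_mul, C_neg, C_1, mul_one, ← one_add_one_eq_two, C_add, C_1]; ring,
    map_smul, smul_eq_mul] at hX
  have hone : Φ.B 1 1 = 0 := by
    have h : Φ.trace 1 = 0 := (mul_eq_zero.1 hX).resolve_left two_ne_zero
    have h1 : aeval (hA P) (1 : ℂ[X]) = 1 := map_one _
    change Φ.B (aeval (hA P) 1) 1 = 0 at h
    rwa [h1] at h
  obtain ⟨r, hr, h⟩ := hpos 1 (AP_one_ne_zero P)
  rw [hone] at h
  exact hr.ne (by exact_mod_cast h)

end
end
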